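/- Three vertices u, v, w form a 3-cut in a 3-connected planar graph G if and only if each pair of them lies on a common face of the planar embedding of G, but no face contains all three of them. -/

import Mathlib

open SimpleGraph Set

/-- A plane embedding of a simple graph: vertices are mapped to points of the plane,
edges to injective arcs, such that arcs meet only in common endpoints. -/
structure PlaneEmbedding {V : Type*} (G : SimpleGraph V) where
  vertexMap : V → ℝ × ℝ
  vertex_inj : Function.Injective vertexMap
  edgeMap : ∀ ⦃a b : V⦄, G.Adj a b → C(unitInterval, ℝ × ℝ)
  edge_start : ∀ ⦃a b : V⦄ (h : G.Adj a b), edgeMap h 0 = vertexMap a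
  edge_end : ∀ ⦃a b : V⦄ (h : G.Adj a b), edgeMap h 1 = vertexMap b
  edge_inj : ∀ ⦃a b : V⦄ (h : G.Adj a b), Function.Injective (edgeMap h)
  edge_symm : ∀ ⦃a b : V⦄ (h : G.Adj a b),
    Set.range (edgeMap h) = Set.range (edgeMap h.symm)
  edge_int : ∀ ⦃a b c d : V⦄ (h : G.Adj a b) (h' : G.Adj c d),
    s(a, b) ≠ s(c, d) →
    Set.range (edgeMap h) ∩ Set.range (edgeMap h') ⊆
      vertexMap '' (({a, b} : Set V) ∩ {c, d})
  edge_no_vertex : ∀ ⦃a b : V⦄ (h : G.Adj a b) (x : V),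
    vertexMap x ∈ Set.range (edgeMap h) → x = a ∨ x = b

variable {V : Type*}

/-- The subset of the plane covered by the drawing of the graph. -/
def PlaneEmbedding.drawing {G : SimpleGraph V} (E : PlaneEmbedding G) : Set (ℝ × ℝ) :=
  Set.range E.vertexMap ∪ ⋃ (a : V) (b : V) (h : G.Adj a b), Set.range (E.edgeMap h)

/-- A face of a plane embedding: a connected component of the complement of the drawing. -/
def PlaneEmbedding.IsFace {G : SimpleGraph V} (E : PlaneEmbedding G)
    (F : Set (ℝ × ℝ)) : Prop :=
  ∃ x ∈ E.drawingᶜ, F = connectedComponentIn E.drawingᶜ x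

/-- A face whose boundary is the union of the arcs of three mutually adjacent vertices. -/
def PlaneEmbedding.FaceIsTriangleOn {G : SimpleGraph V} (E : PlaneEmbedding G)
    (F : Set (ℝ × ℝ)) (a b c : V) : Prop :=
  ∃ (h1 : G.Adj a b) (h2 : G.Adj b c) (h3 : G.Adj c a),
    frontier F = Set.range (E.edgeMap h1) ∪ Set.range (E.edgeMap h2) ∪
      Set.range (E.edgeMap h3)

/-- A face of a plane embedding is a triangle if it is bounded by three arcs of a 3-cycle. -/
def PlaneEmbedding.FaceIsTriangle {G : SimpleGraph V} (E : PlaneEmbedding G)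
    (F : Set (ℝ × ℝ)) : Prop :=
  ∃ a b c : V, E.FaceIsTriangleOn F a b c

/-- `(a,b,c)` is a facial triangle of the embedding `E`. -/
def PlaneEmbedding.IsFacialTriangle {G : SimpleGraph V} (E : PlaneEmbedding G)
    (a b c : V) : Prop :=
  ∃ F : Set (ℝ × ℝ), E.IsFace F ∧ E.FaceIsTriangleOn F a b c

/-- A graph is planar if it admits a plane embedding. -/
def IsPlanar (G : SimpleGraph V) : Prop := Nonempty (PlaneEmbedding G)

/-- A graph is `k`-connected if it has more than `k` vertices and removing fewer than
`k` vertices always leaves a connected graph. -/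
def IsKConnected (k : ℕ) (G : SimpleGraph V) : Prop :=
  k < Nat.card V ∧ ∀ S : Set V, S.Finite → S.ncard < k → (G.induce Sᶜ).Connected

/-- A 3-cut: a set of 3 vertices whose removal disconnects the graph. -/
def IsThreeCut (G : SimpleGraph V) (S : Set V) : Prop :=
  S.ncard = 3 ∧ ¬ (G.induce Sᶜ).Preconnected

/-- `C` is (the vertex set of) a connected component of `G - S`. -/
def IsCompOf (G : SimpleGraph V) (S : Set V) (C : Set V) : Prop :=
  C.Nonempty ∧ C ⊆ Sᶜ ∧ (G.induce C).Connected ∧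
    ∀ a ∈ C, ∀ b ∈ Sᶜ, G.Adj a b → b ∈ C

/-- The edge closed component of `G - {u,v,w}` corresponding to the component `C`:
the graph induced on `C ∪ {u,v,w}` with the edges `uv`, `vw`, `wu` added. -/
def edgeClosedGraph (G : SimpleGraph V) (u v w : V) (C : Set V) :
    SimpleGraph ↥(C ∪ {u, v, w}) :=
  SimpleGraph.fromRel (fun a b =>
    G.Adj a b ∨ ((a : V) ∈ ({u, v, w} : Set V) ∧ (b : V) ∈ ({u, v, w} : Set V)))
/-- `f` has a continuous logarithm on `K`. -/
def HasLogOn (K : Set ℂ) (f : ℂ → ℂ) : Prop :=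
  ∃ L : ℂ → ℂ, ContinuousOn L K ∧ ∀ z ∈ K, Complex.exp (L z) = f z

theorem exists_continuous_log {A : Type*} [TopologicalSpace A] [SimplyConnectedSpace A]
    [LocallyPathConnectedSpace A] (f : C(A, ℂ)) (hf : ∀ a, f a ≠ 0) :
    ∃ F : C(A, ℂ), ∀ a, Complex.exp (F a) = f a := by
  obtain ⟨a₀⟩ : Nonempty A := inferInstance
  obtain ⟨F, ⟨-, hF⟩, -⟩ := Complex.isCoveringMapOn_exp.existsUnique_continuousMap_lifts f
    (a₀ := a₀) (e₀ := Complex.log (f a₀)) (Complex.exp_log (hf a₀)) (fun a => hf a)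
  exact ⟨F, fun a => congrFun hF a⟩

/-- Two continuous logarithms of the same function on a preconnected set differ by a constant
multiple of `2πi`. -/
theorem exists_int_log_eq {X : Type*} [TopologicalSpace X] {s : Set X} (hs : IsPreconnected s)
    {L M : X → ℂ} (hL : ContinuousOn L s) (hM : ContinuousOn M s)
    (h : ∀ x ∈ s, Complex.exp (L x) = Complex.exp (M x)) :
    ∃ n : ℤ, ∀ x ∈ s, L x = M x + n * (2 * Real.pi * Complex.I) := by
  have hint : ∀ x ∈ s, ∃ n : ℤ, L x = M x + n * (2 * Real.pi * Complex.I) := fun x hx =>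
    Complex.exp_eq_exp_iff_exists_int.1 (h x hx)
  rcases s.eq_empty_or_nonempty with rfl | ⟨x₀, hx₀⟩
  · exact ⟨0, by simp⟩
  have hc : ContinuousOn (fun x => (L x - M x) / (2 * Real.pi * Complex.I)) s :=
    (hL.sub hM).div_const _
  have hne : (2 * Real.pi * Complex.I : ℂ) ≠ 0 := Complex.two_pi_I_ne_zero
  have hc' : ContinuousOn (fun x => ((L x - M x) / (2 * Real.pi * Complex.I)).re) s :=
    Complex.continuous_re.comp_continuousOn hc
  have key : ∀ x ∈ s, ∀ n : ℤ, L x = M x + n * (2 * Real.pi * Complex.I) →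
      ((L x - M x) / (2 * Real.pi * Complex.I)).re = n := by
    intro x hx n hn
    rw [hn, add_sub_cancel_left, mul_div_assoc, div_self hne]
    simp
  obtain ⟨n₀, hn₀⟩ := hint x₀ hx₀
  refine ⟨n₀, fun x hx => ?_⟩
  obtain ⟨n, hn⟩ := hint x hx
  have hmem : Set.MapsTo (fun x => ((L x - M x) / (2 * Real.pi * Complex.I)).re) s
      (Set.range ((↑) : ℤ → ℝ)) := by
    intro y hy
    obtain ⟨m, hm⟩ := hint y hy
    exact ⟨m, (key y hy m hm).symm⟩
  have hd : IsDiscrete (Set.range ((↑) : ℤ → ℝ)) :=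
    ⟨Int.isClosedEmbedding_coe_real.isEmbedding.toHomeomorph.symm.isEmbedding.discreteTopology⟩
  have := hs.constant_of_mapsTo hd hc' hmem hx hx₀
  rw [key x hx n hn, key x₀ hx₀ n₀ hn₀] at this
  rw [hn]
  have : n = n₀ := by exact_mod_cast this
  rw [this]

theorem HasLogOn.div {K : Set ℂ} {f g : ℂ → ℂ} (hf : HasLogOn K f) (hg : HasLogOn K g) :
    HasLogOn K (fun z => f z / g z) := by
  obtain ⟨L, hL, hL'⟩ := hf
  obtain ⟨M, hM, hM'⟩ := hg
  exact ⟨fun z => L z - M z, hL.sub hM, fun z hz => by rw [Complex.exp_sub, hL' z hz, hM' z hz]⟩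

theorem HasLogOn.congr {K : Set ℂ} {f g : ℂ → ℂ} (hf : HasLogOn K f) (h : ∀ z ∈ K, f z = g z) :
    HasLogOn K g := by
  obtain ⟨L, hL, hL'⟩ := hf
  exact ⟨L, hL, fun z hz => (hL' z hz).trans (h z hz)⟩

theorem hasLogOn_one (K : Set ℂ) : HasLogOn K (fun _ => 1) :=
  ⟨fun _ => 0, continuousOn_const, fun _ _ => Complex.exp_zero⟩

theorem HasLogOn.inv_div {K : Set ℂ} {f g : ℂ → ℂ} (h : HasLogOn K (fun z => f z / g z)) :
    HasLogOn K (fun z => g z / f z) :=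
  ((hasLogOn_one K).div h).congr fun z _ => by simp

/-- Points in the same component of the complement of `K` are not distinguished by logarithms. -/
theorem hasLogOn_of_mem_connectedComponentIn {K : Set ℂ} (hK : IsClosed K) {p q : ℂ}
    (hq : q ∈ connectedComponentIn Kᶜ p) : HasLogOn K (fun z => (z - q) / (z - p)) := by
  have hp : p ∈ Kᶜ := connectedComponentIn_nonempty_iff.1 ⟨q, hq⟩
  have hsub : ∀ x ∈ connectedComponentIn Kᶜ p, ∀ z ∈ K, z - x ≠ 0 := by
    intro x hx z hz h
    exact connectedComponentIn_subset _ _ hx (sub_eq_zero.1 h ▸ hz)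
  refine isPreconnected_connectedComponentIn.induction₂'
    (P := fun x y => x ∈ connectedComponentIn Kᶜ p → y ∈ connectedComponentIn Kᶜ p →
      HasLogOn K (fun z => (z - y) / (z - x))) ?_ ?_ (mem_connectedComponentIn hp) hq
    (mem_connectedComponentIn hp) hq
  · intro x hx
    have hx' : x ∈ Kᶜ := connectedComponentIn_subset _ _ hx
    obtain ⟨ε, hε, hball⟩ := Metric.isOpen_iff.1 hK.isOpen_compl x hx'
    have hnear : ∀ y ∈ Metric.ball x ε, HasLogOn K (fun z => (z - y) / (z - x)) := by
      intro y hy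
      have hne : ∀ z ∈ K, z - x ≠ 0 := hsub x hx
      have hslit : ∀ z ∈ K, (z - y) / (z - x) ∈ Complex.slitPlane := by
        intro z hz
        suffices h : ‖(z - y) / (z - x) - 1‖ < 1 by
          simpa using Complex.mem_slitPlane_of_norm_lt_one h
        have : (z - y) / (z - x) - 1 = (x - y) / (z - x) := by
          field_simp [hne z hz]; ring
        rw [this, norm_div, div_lt_one (norm_pos_iff.2 (hne z hz))]
        have h1 : ‖x - y‖ < ε := by rw [← dist_eq_norm, _root_.dist_comm]; exact hy
        have h2 : ε ≤ ‖z - x‖ := by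
          by_contra hlt
          exact hball (by rw [Metric.mem_ball, dist_eq_norm]; exact not_le.1 hlt) hz
        linarith
      refine ⟨fun z => Complex.log ((z - y) / (z - x)), ?_, ?_⟩
      · exact ContinuousOn.clog (by
          refine ContinuousOn.div (by fun_prop) (by fun_prop) hne) hslit
      · intro z hz
        exact Complex.exp_log (Complex.slitPlane_ne_zero (hslit z hz))
    filter_upwards [mem_nhdsWithin_of_mem_nhds (Metric.ball_mem_nhds x hε)] with y hy
    exact ⟨fun _ _ => hnear y hy, fun _ _ => (hnear y hy).inv_div⟩
  · intro x y w hx hy hw hxy hyw _ _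
    refine ((hyw hy hw).div (hxy hx hy).inv_div).congr fun z hz => ?_
    have := hsub x hx z hz
    have := hsub y hy z hz
    field_simp

theorem frontier_connectedComponentIn_subset {X : Type*} [TopologicalSpace X]
    [LocallyConnectedSpace X] {K : Set X} (hK : IsClosed K) (p : X) :
    frontier (connectedComponentIn Kᶜ p) ⊆ K := by
  intro x hx
  by_contra hxK
  have ho : IsOpen (connectedComponentIn Kᶜ x) := hK.isOpen_compl.connectedComponentIn
  have hmem : x ∈ connectedComponentIn Kᶜ x := mem_connectedComponentIn hxK
  obtain ⟨y, hy, hyp⟩ := mem_closure_iff.1 (frontier_subset_closure hx) _ ho hmem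
  have h1 := connectedComponentIn_eq hy
  have h2 := connectedComponentIn_eq hyp
  rw [h1, ← h2] at hmem
  have : IsOpen (connectedComponentIn Kᶜ p) := hK.isOpen_compl.connectedComponentIn
  rw [this.frontier_eq] at hx
  exact hx.2 hmem

theorem isPreconnected_norm_gt (R : ℝ) : IsPreconnected {z : ℂ | R < ‖z‖} := by
  have himg : {z : ℂ | R < ‖z‖} =
      (fun x : ℝ × ℝ => (x.1 : ℂ) * Complex.exp (x.2 * Complex.I)) '' (Ioi R ×ˢ univ) := by
    ext z
    constructor
    · intro hz
      exact ⟨(‖z‖, z.arg), ⟨hz, mem_univ _⟩, Complex.norm_mul_exp_arg_mul_I z⟩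
    · rintro ⟨⟨r, t⟩, ⟨hr, -⟩, rfl⟩
      have hr' : R < r := hr
      simp only [mem_ofPred_eq, norm_mul, Complex.norm_exp_ofReal_mul_I, Complex.norm_real,
        Real.norm_eq_abs, mul_one]
      exact lt_of_lt_of_le hr' (le_abs_self r)
  rw [himg]
  exact (isPreconnected_Ioi.prod isPreconnected_univ).image _ (by fun_prop)

/-- The function `z - p` has no continuous logarithm on a neighbourhood of infinity. -/
theorem not_exists_log_sub (p : ℂ) (R : ℝ) (H : C(ℂ, ℂ))
    (h : ∀ z, R ≤ ‖z - p‖ → Complex.exp (H z) = z - p) : False := by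
  set r : ℝ := max R 1 with hr
  have hr0 : 0 < r := lt_of_lt_of_le one_pos (le_max_right _ _)
  let c : ℝ → ℂ := fun t => p + r * Complex.exp (t * Complex.I)
  have hc : Continuous c := by fun_prop
  have hexp : ∀ t : ℝ, Complex.exp (H (c t)) = Complex.exp (Real.log r + t * Complex.I) := by
    intro t
    rw [h (c t), Complex.exp_add, ← Complex.ofReal_exp, Real.exp_log hr0]
    · simp [c]
    · simp only [c, add_sub_cancel_left, norm_mul, Complex.norm_exp_ofReal_mul_I, mul_one,
        Complex.norm_real, Real.norm_eq_abs, abs_of_pos hr0]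
      exact le_max_left _ _
  obtain ⟨n, hn⟩ := exists_int_log_eq (s := (univ : Set ℝ)) isPreconnected_univ
    (L := fun t => H (c t)) (M := fun t : ℝ => (Real.log r + t * Complex.I : ℂ))
    (by fun_prop) (by fun_prop) (fun t _ => hexp t)
  have h0 := hn 0 (mem_univ _)
  have h1 := hn (2 * Real.pi) (mem_univ _)
  have hcc : c (2 * Real.pi) = c 0 := by
    simp [c, Complex.exp_two_pi_mul_I]
  rw [hcc, h0] at h1
  have : (2 * Real.pi * Complex.I : ℂ) = 0 := by
    push_cast at h1
    linear_combination -h1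
  exact Complex.two_pi_I_ne_zero this

theorem mem_connectedComponentIn_of_hasLogOn_of_isBounded {K : Set ℂ} (hK : IsClosed K) {p q : ℂ}
    (hp : p ∉ K) (hb : Bornology.IsBounded (connectedComponentIn Kᶜ p))
    (hlog : HasLogOn K (fun z => (z - p) / (z - q))) (hqK : q ∉ K) :
    q ∈ connectedComponentIn Kᶜ p := by
  classical
  by_contra hq
  obtain ⟨L, hL, hL'⟩ := hlog
  obtain ⟨M, hM⟩ := ContinuousMap.exists_restrict_eq hK ⟨K.domRestrict L, hL.domRestrict⟩
  have hM' : ∀ z ∈ K, M z = L z := fun z hz => congrArg (fun f => f ⟨z, hz⟩) hM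
  let G : ℂ → ℂ := fun z => if z ∈ connectedComponentIn Kᶜ p then
    Complex.exp (M z) * (z - q) else z - p
  have hG : Continuous G := by
    refine Continuous.if ?_ (by fun_prop) (by fun_prop)
    intro z hz
    have hzK : z ∈ K := frontier_connectedComponentIn_subset hK p hz
    have : z - q ≠ 0 := fun h => hqK (sub_eq_zero.1 h ▸ hzK)
    rw [hM' z hzK, hL' z hzK]
    field_simp
  have hG0 : ∀ z, G z ≠ 0 := by
    intro z
    by_cases hz : z ∈ connectedComponentIn Kᶜ p
    · simp only [G, if_pos hz]
      exact mul_ne_zero (Complex.exp_ne_zero _) fun h => hq (sub_eq_zero.1 h ▸ hz)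
    · simp only [G, if_neg hz]
      intro h
      rw [sub_eq_zero.1 h] at hz
      exact hz (mem_connectedComponentIn hp)
  obtain ⟨H, hH⟩ := exists_continuous_log ⟨G, hG⟩ hG0
  obtain ⟨R, hR⟩ := (Metric.isBounded_iff_subset_ball p).1 hb
  refine not_exists_log_sub p R H fun z hz => ?_
  rw [hH z]
  have : z ∉ connectedComponentIn Kᶜ p := fun h => by
    have := hR h
    rw [Metric.mem_ball, dist_eq_norm] at this
    linarith
  simp [G, this]

/-- Points of the complement of a compact set `K` which are not distinguished by logarithms
on `K` lie in the same component of the complement. -/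
theorem mem_connectedComponentIn_of_hasLogOn {K : Set ℂ} (hK : IsCompact K) {p q : ℂ}
    (hp : p ∉ K) (hq : q ∉ K) (hlog : HasLogOn K (fun z => (z - p) / (z - q))) :
    q ∈ connectedComponentIn Kᶜ p := by
  by_cases hbp : Bornology.IsBounded (connectedComponentIn Kᶜ p)
  · exact mem_connectedComponentIn_of_hasLogOn_of_isBounded hK.isClosed hp hbp hlog hq
  by_cases hbq : Bornology.IsBounded (connectedComponentIn Kᶜ q)
  · have := mem_connectedComponentIn_of_hasLogOn_of_isBounded hK.isClosed hq hbq hlog.inv_div hp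
    rw [← connectedComponentIn_eq this]
    exact mem_connectedComponentIn hq
  obtain ⟨R, -, hR⟩ := hK.isBounded.subset_ball_lt 0 0
  have hsub : {z : ℂ | R < ‖z‖} ⊆ Kᶜ := by
    intro z hz hzK
    have := hR hzK
    rw [mem_ball_zero_iff] at this
    exact lt_asymm this hz
  have far : ∀ s : Set ℂ, ¬ Bornology.IsBounded s → ∃ z ∈ s, R < ‖z‖ := by
    intro s hs
    by_contra! hcon
    exact hs (Metric.isBounded_closedBall.subset (s := s) (t := Metric.closedBall (0 : ℂ) R)
      fun z hz => mem_closedBall_zero_iff.2 (hcon z hz))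
  obtain ⟨x, hx, hxR⟩ := far _ hbp
  obtain ⟨y, hy, hyR⟩ := far _ hbq
  have hxy : y ∈ connectedComponentIn Kᶜ x :=
    (isPreconnected_norm_gt R).subset_connectedComponentIn hxR hsub hyR
  rw [connectedComponentIn_eq hx, connectedComponentIn_eq hxy, ← connectedComponentIn_eq hy]
  exact mem_connectedComponentIn hq

/-- **Janiszewski's theorem**. -/
theorem janiszewski_complex {A B : Set ℂ} (hA : IsCompact A) (hB : IsCompact B)
    (hAB : IsPreconnected (A ∩ B)) {p q : ℂ} (hpA : q ∈ connectedComponentIn Aᶜ p)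
    (hpB : q ∈ connectedComponentIn Bᶜ p) : q ∈ connectedComponentIn (A ∪ B)ᶜ p := by
  classical
  have hp1 : p ∈ Aᶜ := connectedComponentIn_nonempty_iff.1 ⟨q, hpA⟩
  have hp2 : p ∈ Bᶜ := connectedComponentIn_nonempty_iff.1 ⟨q, hpB⟩
  have hq1 : q ∈ Aᶜ := connectedComponentIn_subset _ _ hpA
  have hq2 : q ∈ Bᶜ := connectedComponentIn_subset _ _ hpB
  obtain ⟨L, hL, hL'⟩ := (hasLogOn_of_mem_connectedComponentIn hA.isClosed hpA).inv_div
  obtain ⟨M, hM, hM'⟩ := (hasLogOn_of_mem_connectedComponentIn hB.isClosed hpB).inv_div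
  obtain ⟨n, hn⟩ := exists_int_log_eq hAB (hL.mono inter_subset_left) (hM.mono inter_subset_right)
    (fun z hz => by rw [hL' z hz.1, hM' z hz.2])
  refine mem_connectedComponentIn_of_hasLogOn (hA.union hB) (by simp_all) (by simp_all) ?_
  refine ⟨fun z => if z ∈ A then L z else M z + n * (2 * Real.pi * Complex.I), ?_, ?_⟩
  · refine ContinuousOn.union_of_isClosed ?_ ?_ hA.isClosed hB.isClosed
    · exact hL.congr fun z hz => by simp [hz]
    · refine ContinuousOn.congr (hM.add (continuousOn_const (c := n * (2 * Real.pi * Complex.I))))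
        fun z hz => ?_
      by_cases hzA : z ∈ A
      · simp [hzA, hn z ⟨hzA, hz⟩]
      · simp [hzA]
  · intro z hz
    by_cases hzA : z ∈ A
    · simp only [hzA, if_true]; exact hL' z hzA
    · simp only [hzA, if_false]
      rw [Complex.exp_add, Complex.exp_int_mul_two_pi_mul_I, mul_one]
      exact hM' z (hz.resolve_left hzA)

theorem exists_continuous_log_unitInterval (f : C(unitInterval, ℂ)) (hf : ∀ a, f a ≠ 0) :
    ∃ F : C(unitInterval, ℂ), ∀ a, Complex.exp (F a) = f a := by
  obtain ⟨F, hF⟩ := exists_continuous_log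
    (f.comp ⟨Set.projIcc (0 : ℝ) 1 zero_le_one, continuous_projIcc⟩) (fun a => hf _)
  refine ⟨F.comp ⟨Subtype.val, continuous_subtype_val⟩, fun a => ?_⟩
  simp [hF]

theorem exists_continuous_log_unitSquare (f : C(unitInterval × unitInterval, ℂ))
    (hf : ∀ a, f a ≠ 0) :
    ∃ F : C(unitInterval × unitInterval, ℂ), ∀ a, Complex.exp (F a) = f a := by
  obtain ⟨F, hF⟩ := exists_continuous_log
    (f.comp ⟨Prod.map (Set.projIcc (0 : ℝ) 1 zero_le_one) (Set.projIcc (0 : ℝ) 1 zero_le_one),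
      continuous_projIcc.prodMap continuous_projIcc⟩) (fun a => hf _)
  refine ⟨F.comp ⟨Prod.map Subtype.val Subtype.val,
    continuous_subtype_val.prodMap continuous_subtype_val⟩, fun a => ?_⟩
  simp [hF, Prod.map]

/-- An arc does not separate the plane. -/
theorem arc_not_separates_complex (γ : C(unitInterval, ℂ)) (hγ : Function.Injective γ)
    {p q : ℂ} (hp : p ∉ range γ) (hq : q ∉ range γ) :
    q ∈ connectedComponentIn (range γ)ᶜ p := by
  have hne : ∀ z ∈ range γ, ∀ x ∉ range γ, z - x ≠ 0 := fun z hz x hx h =>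
    hx (sub_eq_zero.1 h ▸ hz)
  refine mem_connectedComponentIn_of_hasLogOn (isCompact_range γ.continuous) hp hq ?_
  have hcl : Topology.IsClosedEmbedding γ := γ.continuous.isClosedEmbedding hγ
  obtain ⟨F, hF⟩ := exists_continuous_log_unitInterval
    (⟨fun t => (γ t - p) / (γ t - q), by
      refine Continuous.div (by fun_prop) (by fun_prop) fun t => hne _ ⟨t, rfl⟩ q hq⟩ :
        C(unitInterval, ℂ))
    (fun t => div_ne_zero (hne _ ⟨t, rfl⟩ p hp) (hne _ ⟨t, rfl⟩ q hq))
  obtain ⟨L, hL⟩ := ContinuousMap.exists_extension hcl F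
  refine ⟨L, L.continuous.continuousOn, ?_⟩
  rintro _ ⟨t, rfl⟩
  have : L (γ t) = F t := congrArg (fun f => f t) hL
  rw [this]
  exact hF t

/-- The mod 2 obstruction to the planarity of `K₃,₃`. -/
theorem k33_parity (n m : Fin 3 → Fin 3 → Fin 3 → ℤ)
    (h : ∀ i i' j j', i < i' → j ≠ j' →
      (if j < j' then 1 else 0) + n i' i j + m j i' j' - n i i' j' - m j' i j = 0) : False := by
  have e := fun j j' => h 0 1 j j' (by decide)
  have f := fun j j' => h 0 2 j j' (by decide)
  have g := fun j j' => h 1 2 j j' (by decide)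
  have e1 := e 0 1 (by decide)
  have e2 := e 1 0 (by decide)
  have e3 := e 0 2 (by decide)
  have e4 := e 2 0 (by decide)
  have e5 := e 1 2 (by decide)
  have e6 := e 2 1 (by decide)
  have f1 := f 0 1 (by decide)
  have f2 := f 1 0 (by decide)
  have f3 := f 0 2 (by decide)
  have f4 := f 2 0 (by decide)
  have f5 := f 1 2 (by decide)
  have f6 := f 2 1 (by decide)
  have g1 := g 0 1 (by decide)
  have g2 := g 1 0 (by decide)
  have g3 := g 0 2 (by decide)
  have g4 := g 2 0 (by decide)
  have g5 := g 1 2 (by decide)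
  have g6 := g 2 1 (by decide)
  simp only [show (0 : Fin 3) < 1 by decide, show (0 : Fin 3) < 2 by decide,
    show (1 : Fin 3) < 2 by decide, show ¬ (1 : Fin 3) < 0 by decide,
    show ¬ (2 : Fin 3) < 0 by decide, show ¬ (2 : Fin 3) < 1 by decide, if_true, if_false]
    at e1 e2 e3 e4 e5 e6 f1 f2 f3 f4 f5 f6 g1 g2 g3 g4 g5 g6
  clear h e f g
  omega

theorem log_increment_eq {L M : unitInterval → ℂ} (hL : Continuous L) (hM : Continuous M)
    (h : ∀ t, Complex.exp (L t) = Complex.exp (M t)) : L 1 - L 0 = M 1 - M 0 := by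
  obtain ⟨n, hn⟩ := exists_int_log_eq isPreconnected_univ hL.continuousOn hM.continuousOn
    fun t _ => h t
  rw [hn 1 (mem_univ _), hn 0 (mem_univ _)]
  ring

theorem exists_log_antisymm (a : Fin 3 → ℂ) (ha : ∀ i j, i ≠ j → a i ≠ a j) :
    ∃ α : Fin 3 → Fin 3 → ℂ, (∀ i j, i ≠ j → Complex.exp (α i j) = a i - a j) ∧
      ∀ i j, i < j → α j i = α i j + Real.pi * Complex.I := by
  refine ⟨fun i j => if i < j then Complex.log (a i - a j) else
    Complex.log (a j - a i) + Real.pi * Complex.I, fun i j hij => ?_, fun i j hij => ?_⟩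
  · rcases lt_or_gt_of_ne hij with h | h
    · simp only [h, if_true]
      exact Complex.exp_log (sub_ne_zero.2 (ha i j hij))
    · simp only [not_lt_of_gt h, if_false]
      rw [Complex.exp_add, Complex.exp_pi_mul_I, Complex.exp_log (sub_ne_zero.2 (ha j i hij.symm))]
      ring
  · simp [hij, not_lt_of_gt hij]

/-- `K₃,₃` cannot be drawn in the plane so that independent edges are disjoint. -/
theorem k33_complex (a b : Fin 3 → ℂ) (γ : Fin 3 → Fin 3 → C(unitInterval, ℂ))
    (h0 : ∀ i j, γ i j 0 = a i) (h1 : ∀ i j, γ i j 1 = b j)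
    (hdis : ∀ i i' j j', i ≠ i' → j ≠ j' → ∀ s t, γ i j s ≠ γ i' j' t) : False := by
  have third : ∀ j : Fin 3, ∃ j', j' ≠ j := by decide
  have hU : ∀ i i' j', i ≠ i' → ∀ t, γ i' j' t - a i ≠ 0 := by
    intro i i' j' hi t
    obtain ⟨j, hj⟩ := third j'
    rw [← h0 i j]
    exact sub_ne_zero.2 (hdis i i' j j' hi hj 0 t).symm
  have hW : ∀ j i' j', j ≠ j' → ∀ t, γ i' j' t - b j ≠ 0 := by
    intro j i' j' hj t
    obtain ⟨i, hi⟩ := third i'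
    rw [← h1 i j]
    exact sub_ne_zero.2 (hdis i i' j j' hi hj 1 t).symm
  have exU : ∀ i i' j', ∃ U : C(unitInterval, ℂ), i ≠ i' →
      ∀ t, Complex.exp (U t) = γ i' j' t - a i := by
    intro i i' j'
    by_cases hi : i = i'
    · exact ⟨0, fun h => absurd hi h⟩
    · obtain ⟨U, hU⟩ := exists_continuous_log_unitInterval
        (γ i' j' - ContinuousMap.const _ (a i)) (hU i i' j' hi)
      exact ⟨U, fun _ => hU⟩
  have exW : ∀ j i' j', ∃ W : C(unitInterval, ℂ), j ≠ j' →
      ∀ t, Complex.exp (W t) = γ i' j' t - b j := by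
    intro j i' j'
    by_cases hj : j = j'
    · exact ⟨0, fun h => absurd hj h⟩
    · obtain ⟨W, hW⟩ := exists_continuous_log_unitInterval
        (γ i' j' - ContinuousMap.const _ (b j)) (hW j i' j' hj)
      exact ⟨W, fun _ => hW⟩
  choose U hU' using exU
  choose W hW' using exW
  have hab : ∀ i j, a i - b j ≠ 0 := by
    intro i j
    obtain ⟨j', hj'⟩ := third j
    rw [← h0 i j']
    exact hW j i j' hj'.symm 0
  obtain ⟨α, hα, hα'⟩ := exists_log_antisymm a fun i j hij h => by
    have := hU i j 0 hij 0
    rw [h0, h, sub_self] at this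
    exact this rfl
  obtain ⟨β, hβ, hβ'⟩ := exists_log_antisymm b fun i j hij h => by
    have := hW i 0 j hij 1
    rw [h1, h, sub_self] at this
    exact this rfl
  have square : ∀ i i' j j', i ≠ i' → j ≠ j' →
      (U i' i j 1 - U i' i j 0) + (W j i' j' 1 - W j i' j' 0) =
        (U i i' j' 1 - U i i' j' 0) + (W j' i j 1 - W j' i j 0) := by
    intro i i' j j' hi hj
    obtain ⟨F, hF⟩ := exists_continuous_log_unitSquare
      ⟨fun x => γ i j x.1 - γ i' j' x.2, by fun_prop⟩
      (fun x => sub_ne_zero.2 (hdis i i' j j' hi hj x.1 x.2))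
    have hF' : ∀ s t, Complex.exp (F (s, t)) = γ i j s - γ i' j' t := fun s t => hF (s, t)
    have r1 := log_increment_eq (L := fun s => F (s, 0)) (M := U i' i j) (by fun_prop)
      (by fun_prop) (fun s => by rw [hF', hU' i' i j hi.symm, h0])
    have r2 := log_increment_eq (L := fun t => F (1, t)) 
      (M := fun t => W j i' j' t + Real.pi * Complex.I) (by fun_prop)
      (by fun_prop) (fun t => by
        rw [hF', Complex.exp_add, Complex.exp_pi_mul_I, hW' j i' j' hj, h1]; ring)
    have r3 := log_increment_eq (L := fun s => F (s, 1)) (M := W j' i j) (by fun_prop)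
      (by fun_prop) (fun s => by rw [hF', hW' j' i j hj.symm, h1])
    have r4 := log_increment_eq (L := fun t => F (0, t)) 
      (M := fun t => U i i' j' t + Real.pi * Complex.I) (by fun_prop)
      (by fun_prop) (fun t => by
        rw [hF', Complex.exp_add, Complex.exp_pi_mul_I, hU' i i' j' hi, h0]; ring)
    linear_combination -r1 - r2 + r3 + r4
  have exn : ∀ i i' j', ∃ n : ℤ, i ≠ i' → U i i' j' 1 - U i i' j' 0 =
      (Complex.log (a i - b j') + Real.pi * Complex.I - α i' i) +
        n * (2 * Real.pi * Complex.I) := by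
    intro i i' j'
    by_cases hi : i = i'
    · exact ⟨0, fun h => absurd hi h⟩
    · obtain ⟨n, hn⟩ := Complex.exp_eq_exp_iff_exists_int.1
        (show Complex.exp (U i i' j' 1 - U i i' j' 0) =
          Complex.exp (Complex.log (a i - b j') + Real.pi * Complex.I - α i' i) by
          rw [Complex.exp_sub, Complex.exp_sub, Complex.exp_add, Complex.exp_pi_mul_I,
            Complex.exp_log (hab i j'), hU' i i' j' hi, hU' i i' j' hi, h0, h1,
            hα i' i (Ne.symm hi)]
          ring)
      exact ⟨n, fun _ => hn⟩
  have exm : ∀ j i' j', ∃ n : ℤ, j ≠ j' → W j i' j' 1 - W j i' j' 0 =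
      (β j' j - Complex.log (a i' - b j)) + n * (2 * Real.pi * Complex.I) := by
    intro j i' j'
    by_cases hj : j = j'
    · exact ⟨0, fun h => absurd hj h⟩
    · obtain ⟨n, hn⟩ := Complex.exp_eq_exp_iff_exists_int.1
        (show Complex.exp (W j i' j' 1 - W j i' j' 0) =
          Complex.exp (β j' j - Complex.log (a i' - b j)) by
          rw [Complex.exp_sub, Complex.exp_sub,
            Complex.exp_log (hab i' j), hW' j i' j' hj, hW' j i' j' hj, h0, h1,
            hβ j' j (Ne.symm hj)])
      exact ⟨n, fun _ => hn⟩
  choose n hn using exn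
  choose m hm using exm
  refine k33_parity n m fun i i' j j' hi hj => ?_
  have hs := square i i' j j' hi.ne hj
  rw [hn i' i j hi.ne', hm j i' j' hj, hn i i' j' hi.ne, hm j' i j hj.symm, hα' i i' hi] at hs
  have h2 : (2 * Real.pi * Complex.I : ℂ) ≠ 0 := Complex.two_pi_I_ne_zero
  have key : ∀ k : ℤ, (k : ℂ) * (2 * Real.pi * Complex.I) = 0 → k = 0 := by
    intro k hk
    exact_mod_cast (mul_eq_zero.1 hk).resolve_right h2
  apply key
  rcases lt_or_gt_of_ne hj with h | h
  · rw [hβ' j j' h] at hs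
    rw [if_pos h]
    push_cast
    linear_combination hs
  · rw [hβ' j' j h] at hs
    rw [if_neg (not_lt_of_gt h)]
    push_cast
    linear_combination hs

theorem connectedComponentIn_eq_of_frontier_subset {X : Type*} [TopologicalSpace X]
    {K Φ : Set X} {p : X} (hp : p ∈ Φ) (ho : IsOpen Φ) (hc : IsPreconnected Φ)
    (hK : Φ ⊆ Kᶜ) (hf : frontier Φ ⊆ K) : connectedComponentIn Kᶜ p = Φ := by
  refine Subset.antisymm ?_ (hc.subset_connectedComponentIn hp hK)
  refine IsPreconnected.subset_left_of_subset_union (v := (closure Φ)ᶜ) ho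
    isClosed_closure.isOpen_compl
    (disjoint_compl_right.mono_left subset_closure) (fun x hx => ?_)
    ⟨p, mem_connectedComponentIn (hK hp), hp⟩ isPreconnected_connectedComponentIn
  by_contra h
  rw [mem_union, not_or, mem_compl_iff, not_not] at h
  exact connectedComponentIn_subset _ _ hx (hf (by rw [ho.frontier_eq]; exact ⟨h.2, h.1⟩))

theorem mem_connectedComponentIn_of_isPreconnected {X : Type*} [TopologicalSpace X]
    {K T : Set X} {p q : X} (hT : IsPreconnected T) (hp : p ∈ T) (hq : q ∈ T)
    (h : ∀ x ∈ T, x ∉ K) : q ∈ connectedComponentIn Kᶜ p :=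
  hT.subset_connectedComponentIn hp h hq

theorem JoinedIn.mem_connectedComponentIn {X : Type*} [TopologicalSpace X]
    {K T : Set X} {p q : X} (h : JoinedIn T p q) (hTK : Disjoint T K) :
    q ∈ connectedComponentIn Kᶜ p := by
  refine mem_connectedComponentIn_of_isPreconnected (isPreconnected_range h.somePath.continuous)
    ⟨0, h.somePath.source⟩ ⟨1, h.somePath.target⟩ ?_
  rintro _ ⟨t, rfl⟩
  exact Set.disjoint_left.1 hTK (h.somePath_mem t)

theorem mem_connectedComponentIn_symm {X : Type*} [TopologicalSpace X]
    {K : Set X} {p q : X} (h : q ∈ connectedComponentIn K p) : p ∈ connectedComponentIn K q := by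
  rw [← connectedComponentIn_eq h]
  exact mem_connectedComponentIn (connectedComponentIn_nonempty_iff.1 ⟨q, h⟩)

theorem mem_connectedComponentIn_trans {X : Type*} [TopologicalSpace X]
    {K : Set X} {p q r : X} (h : q ∈ connectedComponentIn K p)
    (h' : r ∈ connectedComponentIn K q) : r ∈ connectedComponentIn K p := by
  rwa [connectedComponentIn_eq h]

theorem mem_connectedComponentIn_of_mem_closure {X : Type*} [TopologicalSpace X]
    {K K' : Set X} {p x : X} (hK : K' ⊆ K) (hp : p ∉ K) (hx : x ∉ K')
    (h : x ∈ closure (connectedComponentIn Kᶜ p)) : x ∈ connectedComponentIn K'ᶜ p := by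
  refine mem_connectedComponentIn_of_isPreconnected
    (isPreconnected_connectedComponentIn.subset_closure (subset_insert x _)
      (insert_subset h subset_closure))
    (mem_insert_of_mem _ (mem_connectedComponentIn hp)) (mem_insert _ _) ?_
  rintro y (rfl | hy)
  · exact hx
  · exact fun h => connectedComponentIn_subset _ _ hy (hK h)

theorem Homeomorph.mem_connectedComponentIn_compl_image {X Y : Type*} [TopologicalSpace X]
    [TopologicalSpace Y] (e : X ≃ₜ Y) {K : Set X} {p q : X}
    (h : q ∈ connectedComponentIn Kᶜ p) : e q ∈ connectedComponentIn (e '' K)ᶜ (e p) := by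
  rw [← image_compl_eq e.bijective,
    ← e.image_connectedComponentIn (connectedComponentIn_nonempty_iff.1 ⟨q, h⟩)]
  exact mem_image_of_mem e h

theorem janiszewski {A B : Set (ℝ × ℝ)} (hA : IsCompact A) (hB : IsCompact B)
    (hAB : IsPreconnected (A ∩ B)) {p q : ℝ × ℝ} (hpA : q ∈ connectedComponentIn Aᶜ p)
    (hpB : q ∈ connectedComponentIn Bᶜ p) : q ∈ connectedComponentIn (A ∪ B)ᶜ p := by
  let e : ℝ × ℝ ≃ₜ ℂ := Complex.equivRealProdCLM.toHomeomorph.symm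
  have := janiszewski_complex (hA.image e.continuous) (hB.image e.continuous)
    (by rw [← image_inter e.injective]; exact hAB.image _ e.continuous.continuousOn)
    (e.mem_connectedComponentIn_compl_image hpA) (e.mem_connectedComponentIn_compl_image hpB)
  rw [← image_union] at this
  simpa [← image_comp] using e.symm.mem_connectedComponentIn_compl_image this

theorem arc_not_separates (γ : C(unitInterval, ℝ × ℝ)) (hγ : Function.Injective γ)
    {p q : ℝ × ℝ} (hp : p ∉ range γ) (hq : q ∉ range γ) :
    q ∈ connectedComponentIn (range γ)ᶜ p := by
  let e : ℝ × ℝ ≃ₜ ℂ := Complex.equivRealProdCLM.toHomeomorph.symm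
  have hr : range ((⟨e, e.continuous⟩ : C(ℝ × ℝ, ℂ)).comp γ) = e '' range γ := by
    simp [← range_comp]
  have := arc_not_separates_complex ((⟨e, e.continuous⟩ : C(ℝ × ℝ, ℂ)).comp γ)
    (e.injective.comp hγ) (p := e p) (q := e q)
    (by rw [hr]; simpa using hp) (by rw [hr]; simpa using hq)
  rw [hr] at this
  simpa [← image_comp] using e.symm.mem_connectedComponentIn_compl_image this

/-- Two disjoint triples of points of the plane cannot be joined by nine paths such that
paths with distinct endpoints on both sides are disjoint. -/
theorem k33_plane (a b : Fin 3 → ℝ × ℝ) (T : Fin 3 → Fin 3 → Set (ℝ × ℝ))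
    (hT : ∀ i j, JoinedIn (T i j) (a i) (b j))
    (hdis : ∀ i i' j j', i ≠ i' → j ≠ j' → Disjoint (T i j) (T i' j')) : False := by
  let e : ℝ × ℝ ≃ₜ ℂ := Complex.equivRealProdCLM.toHomeomorph.symm
  refine k33_complex (e ∘ a) (e ∘ b)
    (fun i j => (⟨e, e.continuous⟩ : C(ℝ × ℝ, ℂ)).comp (hT i j).somePath.toContinuousMap)
    (by simp) (by simp) (fun i i' j j' hi hj s t h => ?_)
  have h := e.injective h
  exact disjoint_left.1 (hdis i i' j j' hi hj) ((hT i j).somePath_mem s)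
    (h ▸ (hT i' j').somePath_mem t)

theorem subarc_not_separates (γ : C(unitInterval, ℝ × ℝ)) (hγ : Function.Injective γ)
    {t : unitInterval} (ht : t < 1) {p q : ℝ × ℝ} (hp : p ∉ γ '' Ici t) (hq : q ∉ γ '' Ici t) :
    q ∈ connectedComponentIn (γ '' Ici t)ᶜ p := by
  have ht' : (0 : ℝ) < 1 - t := sub_pos.2 ht
  let r : C(unitInterval, unitInterval) :=
    ⟨fun s => ⟨t + s * (1 - t), by
      constructor
      · have := s.2.1; have := t.2.1; positivity
      · nlinarith [s.2.2, t.2.2]⟩, by fun_prop⟩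
  have hr : range (γ.comp r) = γ '' Ici t := by
    rw [ContinuousMap.coe_comp, range_comp]
    congr 1
    ext x
    constructor
    · rintro ⟨s, rfl⟩
      change (t : ℝ) ≤ t + s * (1 - t)
      have := s.2.1
      nlinarith
    · intro hx
      have hx : (t : ℝ) ≤ x := hx
      refine ⟨⟨(x - t) / (1 - t), div_nonneg (by linarith) ht'.le, ?_⟩, ?_⟩
      · rw [div_le_one ht']; linarith [x.2.2]
      · apply Subtype.ext
        change (t : ℝ) + (x - t) / (1 - t) * (1 - t) = x
        field_simp
        ring
  rw [← hr] at hp hq ⊢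
  refine arc_not_separates (γ.comp r) (hγ.comp fun s s' h => ?_) hp hq
  have h : (t : ℝ) + s * (1 - t) = t + s' * (1 - t) := congrArg Subtype.val h
  apply Subtype.ext
  nlinarith

/-- Attaching an arc at one endpoint does not change which points are separated. -/
theorem union_subarc_not_separates {K : Set (ℝ × ℝ)} (hK : IsCompact K)
    (γ : C(unitInterval, ℝ × ℝ)) (hγ : Function.Injective γ) {t : unitInterval} (ht : t < 1)
    (h1 : K ∩ γ '' Ici t = {γ 1}) {p q : ℝ × ℝ} (h : q ∈ connectedComponentIn Kᶜ p)
    (hp : p ∉ γ '' Ici t) (hq : q ∉ γ '' Ici t) :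
    q ∈ connectedComponentIn (K ∪ γ '' Ici t)ᶜ p :=
  janiszewski hK (isClosed_Ici.isCompact.image γ.continuous)
    (h1 ▸ isPreconnected_singleton) h (subarc_not_separates γ hγ ht hp hq)

theorem exists_pos_forall_le_notMem {X : Type*} [TopologicalSpace X] (γ : C(unitInterval, X))
    {C : Set X} (hC : IsClosed C) (h : γ 0 ∉ C) :
    ∃ t : unitInterval, 0 < t ∧ t < 1 ∧ ∀ s ≤ t, γ s ∉ C := by
  have : ∀ᶠ s in nhds (0 : unitInterval), γ s ∉ C :=
    γ.continuous.continuousAt.eventually (hC.isOpen_compl.mem_nhds h)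
  obtain ⟨l, hl, hl'⟩ := (nhds_bot_basis (α := unitInterval)).eventually_iff.1 this
  obtain ⟨t, ht, ht'⟩ := exists_between (lt_min hl (zero_lt_one : (⊥ : unitInterval) < 1))
  exact ⟨t, ht, ht'.trans_le (min_le_right _ _),
    fun s hs => hl' (hs.trans_lt (ht'.trans_le (min_le_left _ _)))⟩

theorem chord_mem_connectedComponentIn {X : Type*} [TopologicalSpace X] {K : Set X}
    (γ : C(unitInterval, X)) (hint : ∀ t ≠ 0, t ≠ 1 → γ t ∉ K) {s t : unitInterval}
    (hs0 : s ≠ 0) (hs1 : s ≠ 1) (ht0 : t ≠ 0) (ht1 : t ≠ 1) :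
    γ t ∈ connectedComponentIn Kᶜ (γ s) := by
  refine mem_connectedComponentIn_of_isPreconnected (T := γ '' Ioo 0 1)
    (isPreconnected_Ioo.image _ γ.continuous.continuousOn) ⟨s, ?_, rfl⟩ ⟨t, ?_, rfl⟩ ?_
  · exact ⟨unitInterval.pos_iff_ne_zero.2 hs0, unitInterval.lt_one_iff_ne_one.2 hs1⟩
  · exact ⟨unitInterval.pos_iff_ne_zero.2 ht0, unitInterval.lt_one_iff_ne_one.2 ht1⟩
  · rintro _ ⟨x, hx, rfl⟩
    exact hint x hx.1.ne' hx.2.ne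

/-- A face on either side of a chord contains an endpoint of the chord in its closure. -/
theorem endpoint_mem_closure {K : Set (ℝ × ℝ)} (hK : IsCompact K)
    (γ : C(unitInterval, ℝ × ℝ)) (hγ : Function.Injective γ) (h1 : γ 1 ∈ K)
    (hint : ∀ t ≠ 0, t ≠ 1 → γ t ∉ K) {p : ℝ × ℝ} (hp : p ∉ K ∪ range γ)
    {s : unitInterval} (hs0 : s ≠ 0) (hs1 : s ≠ 1) (hs : γ s ∈ connectedComponentIn Kᶜ p) :
    γ 0 ∈ closure (connectedComponentIn (K ∪ range γ)ᶜ p) := by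
  by_contra h0
  set Φ := connectedComponentIn (K ∪ range γ)ᶜ p with hΦ
  obtain ⟨t, ht0, ht1, ht⟩ := exists_pos_forall_le_notMem γ isClosed_closure h0
  have hcl : IsClosed (K ∪ range γ) := hK.isClosed.union (isCompact_range γ.continuous).isClosed
  have hpΦ : p ∈ Φ := mem_connectedComponentIn hp
  have hcomp : connectedComponentIn (K ∪ γ '' Ici t)ᶜ p = Φ := by
    refine connectedComponentIn_eq_of_frontier_subset hpΦ hcl.isOpen_compl.connectedComponentIn
      isPreconnected_connectedComponentIn ((connectedComponentIn_subset _ _).trans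
        (compl_subset_compl.2 (union_subset_union_right K (image_subset_range _ _)))) ?_
    intro x hx
    rcases frontier_connectedComponentIn_subset hcl p hx with h | ⟨r, rfl⟩
    · exact Or.inl h
    · refine Or.inr ⟨r, ?_, rfl⟩
      by_contra hr
      exact ht r (not_le.1 hr).le (frontier_subset_closure hx)
  obtain ⟨r, hr0, hrt⟩ := exists_between ht0
  have hr : γ r ∈ connectedComponentIn Kᶜ p := mem_connectedComponentIn_trans hs
    (chord_mem_connectedComponentIn γ hint hs0 hs1 hr0.ne' (hrt.trans ht1).ne)
  have := union_subarc_not_separates hK γ hγ ht1 ?_ hr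
    (fun h => hp (Or.inr (image_subset_range _ _ h))) ?_
  · rw [hcomp] at this
    exact ht r hrt.le (subset_closure this)
  · ext x
    constructor
    · rintro ⟨hx, y, hy, rfl⟩
      by_contra hne
      exact hint y (ht0.trans_le hy).ne' (fun h => hne (by simp [h])) hx
    · rintro rfl
      exact ⟨h1, 1, ht1.le, rfl⟩
  · rintro ⟨y, hy, hyr⟩
    exact (hγ hyr ▸ hrt).not_ge hy

theorem endpoints_mem_closure {K : Set (ℝ × ℝ)} (hK : IsCompact K)
    (γ : C(unitInterval, ℝ × ℝ)) (hγ : Function.Injective γ) (h0 : γ 0 ∈ K) (h1 : γ 1 ∈ K)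
    (hint : ∀ t ≠ 0, t ≠ 1 → γ t ∉ K) {p : ℝ × ℝ} (hp : p ∉ K ∪ range γ)
    {s : unitInterval} (hs0 : s ≠ 0) (hs1 : s ≠ 1) (hs : γ s ∈ connectedComponentIn Kᶜ p) :
    γ 0 ∈ closure (connectedComponentIn (K ∪ range γ)ᶜ p) ∧
      γ 1 ∈ closure (connectedComponentIn (K ∪ range γ)ᶜ p) := by
  refine ⟨endpoint_mem_closure hK γ hγ h1 hint hp hs0 hs1 hs, ?_⟩
  let γ' := γ.comp ⟨unitInterval.symm, unitInterval.continuous_symm⟩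
  have hr : range γ' = range γ := unitInterval.symm_bijective.surjective.range_comp γ
  have := endpoint_mem_closure hK γ' (hγ.comp unitInterval.symm_bijective.injective)
    (by simpa [γ'] using h0)
    (fun t ht0 ht1 => hint _ (by simpa using ht1) (by simpa using ht0)) (p := p)
    (by rwa [hr]) (s := unitInterval.symm s) (by simpa using hs1) (by simpa using hs0)
    (by simpa [γ'] using hs)
  rw [hr] at this
  simpa [γ'] using this

/-- If arcs issuing from `u` end on `K`, meeting nothing else, then any complementary component
of the union that lies in the component of `Kᶜ` containing `u` has `u` in its closure. -/
theorem center_mem_closure {ι : Type*} [Finite ι] {K : Set (ℝ × ℝ)} (hK : IsCompact K)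
    (γ : ι → C(unitInterval, ℝ × ℝ)) (hγ : ∀ i, Function.Injective (γ i)) {u : ℝ × ℝ}
    (h0 : ∀ i, γ i 0 = u) (h1 : ∀ i, γ i 1 ∈ K) (hint : ∀ i, ∀ t ≠ 1, γ i t ∉ K)
    (hdis : ∀ i j, i ≠ j → range (γ i) ∩ range (γ j) ⊆ {u}) {p : ℝ × ℝ}
    (hp : p ∉ K ∪ ⋃ i, range (γ i)) (hu : u ∈ connectedComponentIn Kᶜ p) :
    u ∈ closure (connectedComponentIn (K ∪ ⋃ i, range (γ i))ᶜ p) := by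
  classical
  have := Fintype.ofFinite ι
  by_contra hcon
  set Φ := connectedComponentIn (K ∪ ⋃ i, range (γ i))ᶜ p with hΦ
  choose t ht0 ht1 ht using fun i =>
    exists_pos_forall_le_notMem (γ i) (isClosed_closure (s := Φ)) (by rwa [h0])
  have hcl : IsClosed (K ∪ ⋃ i, range (γ i)) :=
    hK.isClosed.union (isClosed_iUnion_of_finite fun i =>
      (isCompact_range (γ i).continuous).isClosed)
  have hpΦ : p ∈ Φ := mem_connectedComponentIn hp
  have hsub : ∀ i, γ i '' Ici (t i) ⊆ range (γ i) := fun i => image_subset_range _ _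
  have hcomp : connectedComponentIn (K ∪ ⋃ i, γ i '' Ici (t i))ᶜ p = Φ := by
    refine connectedComponentIn_eq_of_frontier_subset hpΦ hcl.isOpen_compl.connectedComponentIn
      isPreconnected_connectedComponentIn ((connectedComponentIn_subset _ _).trans
        (compl_subset_compl.2 (union_subset_union_right K (iUnion_mono hsub)))) ?_
    intro x hx
    rcases frontier_connectedComponentIn_subset hcl p hx with h | h
    · exact Or.inl h
    · obtain ⟨i, r, rfl⟩ := mem_iUnion.1 h
      refine Or.inr (mem_iUnion.2 ⟨i, r, ?_, rfl⟩)
      by_contra hr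
      exact ht i r (not_le.1 hr).le (frontier_subset_closure hx)
  have huarc : ∀ i, u ∉ γ i '' Ici (t i) := by
    rintro i ⟨s, hs, hsu⟩
    rw [← h0 i] at hsu
    exact (hγ i hsu ▸ ht0 i).not_ge hs
  have key : ∀ s : Finset ι, u ∈ connectedComponentIn (K ∪ ⋃ i ∈ s, γ i '' Ici (t i))ᶜ p := by
    intro s
    induction s using Finset.induction_on with
    | empty => simpa using hu
    | insert i s hi ih =>
      have hset : K ∪ ⋃ j ∈ insert i s, γ j '' Ici (t j) =
          (K ∪ ⋃ j ∈ s, γ j '' Ici (t j)) ∪ γ i '' Ici (t i) := by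
        rw [Finset.set_biUnion_insert, union_comm (γ i '' _), union_assoc]
      rw [hset]
      refine union_subarc_not_separates
        (hK.union (s.isCompact_biUnion fun j _ => isClosed_Ici.isCompact.image (γ j).continuous))
        (γ i) (hγ i) (ht1 i) ?_ ih
        (fun h => hp (Or.inr (mem_iUnion.2 ⟨i, hsub i h⟩))) (huarc i)
      ext x
      constructor
      · rintro ⟨hx | hx, hxi⟩
        · obtain ⟨y, hy, rfl⟩ := hxi
          by_contra hne
          exact hint i y (fun h => hne (by simp [h])) hx
        · obtain ⟨j, hj, hx⟩ := mem_iUnion₂.1 hx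
          have hij : i ≠ j := fun h => hi (h ▸ hj)
          have : x = u := hdis i j hij ⟨hsub i hxi, hsub j hx⟩
          exact absurd (this ▸ hxi) (huarc i)
      · rintro rfl
        exact ⟨Or.inl (h1 i), 1, (ht1 i).le, rfl⟩
  have := key Finset.univ
  simp only [Finset.mem_univ, iUnion_true] at this
  rw [hcomp] at this
  exact hcon (subset_closure this)

/-- The component of the complement of `K` crossed by a chord is not covered by the chord. -/
theorem exists_notMem_range_of_chord {K : Set (ℝ × ℝ)} (hK : IsClosed K)
    (γ : C(unitInterval, ℝ × ℝ)) (h0 : γ 0 ∈ K) (h1 : γ 1 ∈ K)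
    (hint : ∀ t ≠ 0, t ≠ 1 → γ t ∉ K) {s : unitInterval} (hs0 : s ≠ 0) (hs1 : s ≠ 1) :
    ∃ p ∈ connectedComponentIn Kᶜ (γ s), p ∉ range γ := by
  by_contra! hcon
  set Ω := connectedComponentIn Kᶜ (γ s)
  have hΩK : Ω ⊆ Kᶜ := connectedComponentIn_subset _ _
  have hrank : 1 < Module.rank ℝ (ℝ × ℝ) := by
    apply Module.one_lt_rank_of_one_lt_finrank; simp
  have hs := hint s hs0 hs1
  have hΩ : ∀ t, γ t ∈ Ω ∨ γ t = γ 0 ∨ γ t = γ 1 := by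
    intro t
    by_cases h0 : t = 0
    · simp [h0]
    by_cases h1 : t = 1
    · simp [h1]
    exact Or.inl (chord_mem_connectedComponentIn γ hint hs0 hs1 h0 h1)
  have hcomp : connectedComponentIn ({γ 0, γ 1} : Set (ℝ × ℝ))ᶜ (γ s) = Ω := by
      refine connectedComponentIn_eq_of_frontier_subset (mem_connectedComponentIn hs)
        hK.isOpen_compl.connectedComponentIn isPreconnected_connectedComponentIn
        (fun x hx h => ?_) (fun x hx => ?_)
      · rcases h with rfl | rfl
        · exact hΩK hx h0
        · exact hΩK hx h1
      · have hx1 : x ∈ range γ :=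
          closure_minimal hcon (isCompact_range γ.continuous).isClosed (frontier_subset_closure hx)
        obtain ⟨t, rfl⟩ := hx1
        exact (hΩ t).resolve_left
          fun h => hΩK h (frontier_connectedComponentIn_subset hK _ hx)
  have hpre := (((finite_singleton (γ 1)).insert (γ 0)).countable.isConnected_compl_of_one_lt_rank
    hrank).isPreconnected
  rw [hpre.connectedComponentIn (fun h => by
    rcases h with h | h
    · exact hs (h ▸ h0)
    · exact hs (h ▸ h1))] at hcomp
  have huniv : range γ = univ := by
    refine eq_univ_of_forall fun x => ?_
    by_cases hx : x ∈ ({γ 0, γ 1} : Set (ℝ × ℝ))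
    · rcases hx with rfl | rfl <;> exact mem_range_self _
    · exact hcon x (hcomp ▸ hx)
  exact noncompact_univ (ℝ × ℝ) (huniv ▸ isCompact_range γ.continuous)

theorem joinedIn_image_Iic {X : Type*} [TopologicalSpace X] (γ : C(unitInterval, X))
    (t : unitInterval) : JoinedIn (γ '' Iic t) (γ 0) (γ t) :=
  ⟨⟨⟨fun s => γ (s * t), by fun_prop⟩, by simp, by simp⟩,
    fun s => ⟨s * t, unitInterval.mul_le_right, rfl⟩⟩

namespace PlaneEmbedding

variable {G : SimpleGraph V} (E : PlaneEmbedding G)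

/-- The subset of the plane covered by the drawing of a subgraph. -/
def draw (H : G.Subgraph) : Set (ℝ × ℝ) :=
  E.vertexMap '' H.verts ∪ ⋃ (a : V) (b : V) (h : H.Adj a b), range (E.edgeMap h.adj_sub)

/-- The subset of the plane covered by the drawing of the subgraph induced on `W`. -/
abbrev drawOn (W : Set V) : Set (ℝ × ℝ) := E.draw ((⊤ : G.Subgraph).induce W)

variable {E}

theorem mem_draw {H : G.Subgraph} {z : ℝ × ℝ} :
    z ∈ E.draw H ↔ (∃ a ∈ H.verts, E.vertexMap a = z) ∨
      ∃ a b, ∃ h : H.Adj a b, z ∈ range (E.edgeMap h.adj_sub) := by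
  simp only [draw, mem_union, mem_image, mem_iUnion]

theorem vertexMap_mem_draw {H : G.Subgraph} {a : V} :
    E.vertexMap a ∈ E.draw H ↔ a ∈ H.verts := by
  rw [mem_draw]
  constructor
  · rintro (⟨b, hb, h⟩ | ⟨b, c, h, hz⟩)
    · exact E.vertex_inj h ▸ hb
    · rcases E.edge_no_vertex _ _ hz with rfl | rfl
      · exact h.fst_mem
      · exact h.snd_mem
  · exact fun h => Or.inl ⟨a, h, rfl⟩

theorem range_edgeMap_subset_draw {H : G.Subgraph} {a b : V} (h : H.Adj a b) :
    range (E.edgeMap h.adj_sub) ⊆ E.draw H :=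
  fun _ hz => mem_draw.2 (Or.inr ⟨a, b, h, hz⟩)

theorem draw_mono {H₁ H₂ : G.Subgraph} (h : H₁ ≤ H₂) : E.draw H₁ ⊆ E.draw H₂ := by
  intro z hz
  rcases mem_draw.1 hz with ⟨a, ha, hz⟩ | ⟨a, b, hab, hz⟩
  · exact mem_draw.2 (Or.inl ⟨a, h.1 ha, hz⟩)
  · exact range_edgeMap_subset_draw (h.2 hab) hz

theorem isCompact_draw [Finite V] (H : G.Subgraph) : IsCompact (E.draw H) := by
  refine (H.verts.toFinite.image _).isCompact.union ?_
  refine isCompact_iUnion fun a => isCompact_iUnion fun b => isCompact_iUnion fun h =>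
    isCompact_range (E.edgeMap _).continuous

theorem draw_top : E.draw ⊤ = E.drawing := by
  simp [draw, drawing]

theorem draw_sup (H₁ H₂ : G.Subgraph) : E.draw (H₁ ⊔ H₂) = E.draw H₁ ∪ E.draw H₂ := by
  refine Subset.antisymm (fun z hz => ?_)
    (union_subset (draw_mono le_sup_left) (draw_mono le_sup_right))
  rcases mem_draw.1 hz with ⟨a, ha | ha, hz⟩ | ⟨a, b, hab | hab, hz⟩
  · exact Or.inl (mem_draw.2 (Or.inl ⟨a, ha, hz⟩))
  · exact Or.inr (mem_draw.2 (Or.inl ⟨a, ha, hz⟩))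
  · exact Or.inl (range_edgeMap_subset_draw hab hz)
  · exact Or.inr (range_edgeMap_subset_draw hab hz)

theorem draw_inf (H₁ H₂ : G.Subgraph) : E.draw (H₁ ⊓ H₂) = E.draw H₁ ∩ E.draw H₂ := by
  refine Subset.antisymm (subset_inter (draw_mono inf_le_left) (draw_mono inf_le_right)) ?_
  have hv : ∀ x, E.vertexMap x ∈ E.draw H₁ → E.vertexMap x ∈ E.draw H₂ →
      E.vertexMap x ∈ E.draw (H₁ ⊓ H₂) := fun x h₁ h₂ =>
    vertexMap_mem_draw.2 ⟨vertexMap_mem_draw.1 h₁, vertexMap_mem_draw.1 h₂⟩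
  rintro z ⟨h₁, h₂⟩
  rcases mem_draw.1 h₁ with ⟨a, ha, rfl⟩ | ⟨a, b, hab, hz₁⟩
  · exact hv a h₁ h₂
  rcases mem_draw.1 h₂ with ⟨c, hc, rfl⟩ | ⟨c, d, hcd, hz₂⟩
  · exact hv c h₁ h₂
  by_cases hs : s(a, b) = s(c, d)
  · have hab₂ : H₂.Adj a b := by rwa [← Subgraph.mem_edgeSet, hs, Subgraph.mem_edgeSet]
    exact range_edgeMap_subset_draw (H := H₁ ⊓ H₂) ⟨hab, hab₂⟩ hz₁
  · obtain ⟨x, -, rfl⟩ := E.edge_int hab.adj_sub hcd.adj_sub hs ⟨hz₁, hz₂⟩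
    exact hv x h₁ h₂

theorem adj_of_edgeMap_mem_draw {H : G.Subgraph} {a b : V} (h : G.Adj a b) {t : unitInterval}
    (h0 : t ≠ 0) (h1 : t ≠ 1) (ht : E.edgeMap h t ∈ E.draw H) : H.Adj a b := by
  have hv : ∀ x, E.vertexMap x ≠ E.edgeMap h t := by
    intro x hx
    rcases E.edge_no_vertex h x (hx ▸ mem_range_self t) with rfl | rfl
    · exact h0 (E.edge_inj h (by rw [← hx, E.edge_start]))
    · exact h1 (E.edge_inj h (by rw [← hx, E.edge_end]))
  rcases mem_draw.1 ht with ⟨c, -, hc⟩ | ⟨c, d, hcd, hz⟩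
  · exact absurd hc (hv c)
  by_contra hab
  obtain ⟨x, -, hx⟩ := E.edge_int h hcd.adj_sub (fun hs => hab (by
    rwa [← Subgraph.mem_edgeSet, hs, Subgraph.mem_edgeSet])) ⟨mem_range_self t, hz⟩
  exact hv x hx

theorem drawOn_inter (W₁ W₂ : Set V) : E.drawOn (W₁ ∩ W₂) = E.drawOn W₁ ∩ E.drawOn W₂ := by
  rw [drawOn, drawOn, drawOn, ← draw_inf]
  congr 1
  ext a b <;> simp only [Subgraph.induce_verts, Subgraph.verts_inf, Subgraph.induce_adj,
    Subgraph.inf_adj, mem_inter_iff]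
  tauto

theorem drawOn_union {W₁ W₂ : Set V} (h : ∀ a ∈ W₁, ∀ b ∈ W₂, G.Adj a b → a ∈ W₂ ∨ b ∈ W₁) :
    E.drawOn (W₁ ∪ W₂) = E.drawOn W₁ ∪ E.drawOn W₂ := by
  rw [drawOn, drawOn, drawOn, ← draw_sup]
  congr 1
  ext a b
  · simp
  · simp only [Subgraph.induce_adj, Subgraph.sup_adj, mem_union, Subgraph.top_adj]
    have h1 := h a
    have h2 := h b
    constructor
    · rintro ⟨ha | ha, hb | hb, hab⟩
      · tauto
      · rcases h a ha b hb hab <;> tauto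
      · rcases h b hb a ha hab.symm <;> tauto
      · tauto
    · tauto

theorem drawOn_mono {W₁ W₂ : Set V} (h : W₁ ⊆ W₂) : E.drawOn W₁ ⊆ E.drawOn W₂ :=
  draw_mono (Subgraph.induce_mono_right h)

theorem drawOn_univ : E.drawOn univ = E.drawing := by
  have : (⊤ : G.Subgraph).induce univ = ⊤ := by ext <;> simp
  rw [← draw_top, drawOn, this]

theorem vertexMap_mem_drawOn {W : Set V} {a : V} : E.vertexMap a ∈ E.drawOn W ↔ a ∈ W :=
  vertexMap_mem_draw

theorem joinedIn_range_edgeMap {a b : V} (h : G.Adj a b) :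
    JoinedIn (range (E.edgeMap h)) (E.vertexMap a) (E.vertexMap b) :=
  ⟨⟨E.edgeMap h, E.edge_start h, E.edge_end h⟩, fun t => mem_range_self t⟩

theorem joinedIn_draw_of_adj {H : G.Subgraph} {a b : V} (h : H.Adj a b) :
    JoinedIn (E.draw H) (E.vertexMap a) (E.vertexMap b) :=
  (joinedIn_range_edgeMap h.adj_sub).mono (range_edgeMap_subset_draw h)

theorem joinedIn_drawOn_of_adj {W : Set V} {a b : V} (ha : a ∈ W) (hb : b ∈ W) (h : G.Adj a b) :
    JoinedIn (E.drawOn W) (E.vertexMap a) (E.vertexMap b) :=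
  joinedIn_draw_of_adj (H := (⊤ : G.Subgraph).induce W) ⟨ha, hb, h⟩

theorem joinedIn_drawOn_of_reachable {W : Set V} {a b : W} (h : (G.induce W).Reachable a b) :
    JoinedIn (E.drawOn W) (E.vertexMap a) (E.vertexMap b) := by
  obtain ⟨p⟩ := h
  induction p with
  | nil => exact JoinedIn.refl (vertexMap_mem_drawOn.2 (Subtype.coe_prop _))
  | cons h _ ih =>
    exact (joinedIn_drawOn_of_adj (Subtype.coe_prop _) (Subtype.coe_prop _) h).trans ih

theorem isPathConnected_draw {H : G.Subgraph} {a : V} (ha : a ∈ H.verts)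
    (h : ∀ b ∈ H.verts, JoinedIn (E.draw H) (E.vertexMap a) (E.vertexMap b)) :
    IsPathConnected (E.draw H) := by
  refine ⟨E.vertexMap a, vertexMap_mem_draw.2 ha, fun {z} hz => ?_⟩
  rcases mem_draw.1 hz with ⟨b, hb, rfl⟩ | ⟨b, c, hbc, hz⟩
  · exact h b hb
  · refine (h b hbc.fst_mem).trans (JoinedIn.mono ?_ (range_edgeMap_subset_draw hbc))
    obtain ⟨t, rfl⟩ := hz
    rw [← E.edge_start hbc.adj_sub]
    exact (joinedIn_image_Iic _ t).mono (image_subset_range _ _)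

theorem isPathConnected_drawOn {W : Set V} (h : (G.induce W).Connected) :
    IsPathConnected (E.drawOn W) := by
  obtain ⟨a⟩ := h.nonempty
  exact isPathConnected_draw (H := (⊤ : G.Subgraph).induce W) a.2
    (fun b hb => joinedIn_drawOn_of_reachable (h.preconnected a ⟨b, hb⟩))

theorem mem_frontier_iff_of_isFace [Finite V] {F : Set (ℝ × ℝ)} (hF : E.IsFace F) (a : V) :
    E.vertexMap a ∈ frontier F ↔ E.vertexMap a ∈ closure F := by
  obtain ⟨x, -, rfl⟩ := hF
  have hcl : IsClosed E.drawing := draw_top (E := E) ▸ (isCompact_draw ⊤).isClosed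
  rw [hcl.isOpen_compl.connectedComponentIn.frontier_eq]
  refine ⟨And.left, fun h => ⟨h, fun h' => connectedComponentIn_subset _ _ h' ?_⟩⟩
  exact Or.inl ⟨a, rfl⟩

end PlaneEmbedding

theorem SimpleGraph.Reachable.mem_of_forall_adj {H : SimpleGraph V} {C : Set V}
    (hC : ∀ a ∈ C, ∀ b, H.Adj a b → b ∈ C) {a b : V} (h : H.Reachable a b) (ha : a ∈ C) :
    b ∈ C := by
  obtain ⟨p⟩ := h
  induction p with
  | nil => exact ha
  | cons hab _ ih => exact ih (hC _ ha _ hab)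

theorem isCompOf_reachable (G : SimpleGraph V) {S : Set V} (x : ↥Sᶜ) :
    IsCompOf G S {a | ∃ h : a ∈ Sᶜ, (G.induce Sᶜ).Reachable x ⟨a, h⟩} := by
  have hclosed : ∀ a ∈ {a | ∃ h : a ∈ Sᶜ, (G.induce Sᶜ).Reachable x ⟨a, h⟩}, ∀ b ∈ Sᶜ,
      G.Adj a b → b ∈ {a | ∃ h : a ∈ Sᶜ, (G.induce Sᶜ).Reachable x ⟨a, h⟩} := by
    rintro a ⟨ha, hxa⟩ b hb hab
    exact ⟨hb, hxa.trans (Adj.reachable (by simpa using hab))⟩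
  set C := {a | ∃ h : a ∈ Sᶜ, (G.induce Sᶜ).Reachable x ⟨a, h⟩} with hCdef
  have hx : (x : V) ∈ C := ⟨x.2, Reachable.rfl⟩
  refine ⟨⟨x, hx⟩, fun a ha => ha.1, ?_, hclosed⟩
  have key : ∀ a : ↥Sᶜ, (G.induce Sᶜ).Reachable x a →
      ∃ h : (a : V) ∈ C, (G.induce C).Reachable ⟨x, hx⟩ ⟨a, h⟩ := by
    intro a ha
    rw [reachable_iff_reflTransGen] at ha
    induction ha with
    | refl => exact ⟨hx, Reachable.rfl⟩
    | tail _ hbc ih =>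
      obtain ⟨hb, hxb⟩ := ih
      have hbc := induce_adj.1 hbc
      exact ⟨hclosed _ hb _ (Subtype.coe_prop _) hbc,
        hxb.trans (Adj.reachable (by simpa using hbc))⟩
  have hxa : ∀ a : C, (G.induce C).Reachable ⟨x, hx⟩ a := fun ⟨a, ha⟩ => (key ⟨a, ha.1⟩ ha.2).2
  exact { preconnected := fun a b => (hxa a).symm.trans (hxa b), nonempty := ⟨⟨x, hx⟩⟩ }

theorem IsKConnected.exists_adj_of_isCompOf [Finite V] {G : SimpleGraph V} {k : ℕ}
    (hG : IsKConnected k G) {S C : Set V} (hS : S.ncard = k) (hC : IsCompOf G S C) {y : V}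
    (hyS : y ∉ S) (hyC : y ∉ C) {s : V} (hs : s ∈ S) : ∃ c ∈ C, G.Adj s c := by
  obtain ⟨⟨c, hc⟩, hCS, -, hclosed⟩ := hC
  by_contra! hcon
  have hconn := hG.2 (S \ {s}) (toFinite _) (by
    rw [ncard_sdiff_singleton_of_mem hs, hS]
    have := (ncard_pos (toFinite S)).2 ⟨s, hs⟩
    omega)
  have hr := hconn.preconnected ⟨c, fun h => hCS hc h.1⟩ ⟨y, fun h => hyS h.1⟩
  have := hr.mem_of_forall_adj (C := Subtype.val ⁻¹' C) (fun a ha b hab => ?_) hc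
  · exact hyC this
  · have hab := induce_adj.1 hab
    by_cases hbs : (b : V) = s
    · rw [hbs] at hab
      exact absurd hab.symm (hcon _ ha)
    · exact hclosed _ ha _ (fun h => b.2 ⟨h, hbs⟩) hab

/-- A 3-cut of a 3-connected graph leaves two components, each attached to all of the cut. -/
theorem IsThreeCut.exists_components [Finite V] {G : SimpleGraph V} (hG : IsKConnected 3 G)
    {S : Set V} (hS : IsThreeCut G S) :
    ∃ C D : Set V, IsCompOf G S C ∧ IsCompOf G S D ∧ Disjoint C D ∧
      (∀ s ∈ S, ∃ c ∈ C, G.Adj s c) ∧ ∀ s ∈ S, ∃ d ∈ D, G.Adj s d := by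
  obtain ⟨hcard, hpre⟩ := hS
  simp only [SimpleGraph.Preconnected, not_forall] at hpre
  obtain ⟨x, y, hxy⟩ := hpre
  have hC := isCompOf_reachable G x
  have hD := isCompOf_reachable G y
  refine ⟨_, _, hC, hD, ?_, fun s hs => ?_, fun s hs => ?_⟩
  · rw [Set.disjoint_left]
    rintro a ⟨ha, hxa⟩ ⟨_, hya⟩
    exact hxy (hxa.trans hya.symm)
  · exact hG.exists_adj_of_isCompOf hcard hC y.2 (fun ⟨_, h⟩ => hxy h) hs
  · exact hG.exists_adj_of_isCompOf hcard hD x.2 (fun ⟨_, h⟩ => hxy h.symm) hs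

theorem PlaneEmbedding.joinedIn_drawOn_of_attached {G : SimpleGraph V} {E : PlaneEmbedding G}
    {C W : Set V} (hC : (G.induce C).Connected) (hCW : C ⊆ W) {a : V} (ha : a ∈ W)
    (hac : ∃ c ∈ C, G.Adj a c) {c : V} (hc : c ∈ C) :
    JoinedIn (E.drawOn W) (E.vertexMap c) (E.vertexMap a) := by
  obtain ⟨c', hc', hac⟩ := hac
  exact ((joinedIn_drawOn_of_reachable (hC.preconnected ⟨c, hc⟩ ⟨c', hc'⟩)).mono
    (drawOn_mono hCW)).trans (joinedIn_drawOn_of_adj (hCW hc') ha hac.symm)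

namespace PlaneEmbedding

variable {G : SimpleGraph V} {E : PlaneEmbedding G}

theorem draw_subgraphOfAdj {a b : V} (h : G.Adj a b) :
    E.draw (G.subgraphOfAdj h) = range (E.edgeMap h) := by
  refine Subset.antisymm (fun z hz => ?_)
    (range_edgeMap_subset_draw (H := G.subgraphOfAdj h) (by simp))
  rcases mem_draw.1 hz with ⟨c, hc, rfl⟩ | ⟨c, d, hcd, hz⟩
  · rcases hc with rfl | rfl
    · exact ⟨0, E.edge_start h⟩
    · exact ⟨1, E.edge_end h⟩
  · rw [subgraphOfAdj_adj] at hcd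
    rcases Sym2.eq_iff.1 hcd with ⟨rfl, rfl⟩ | ⟨rfl, rfl⟩
    · exact hz
    · rwa [E.edge_symm h]

theorem drawOn_empty : E.drawOn ∅ = ∅ :=
  eq_empty_of_forall_notMem fun z hz => by
    rcases mem_draw.1 hz with ⟨c, hc, rfl⟩ | ⟨c, d, hcd, hz⟩
    · exact hc
    · exact hcd.1

theorem disjoint_drawOn {W₁ W₂ : Set V} (h : Disjoint W₁ W₂) :
    Disjoint (E.drawOn W₁) (E.drawOn W₂) := by
  rw [Set.disjoint_iff_inter_eq_empty] at *
  rw [← drawOn_inter, h, drawOn_empty]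

theorem isPathConnected_drawOn_singleton (a : V) : IsPathConnected (E.drawOn {a}) :=
  isPathConnected_draw (H := (⊤ : G.Subgraph).induce {a}) (mem_singleton a) fun b hb => by
    rw [mem_singleton_iff.1 hb]
    exact JoinedIn.refl (vertexMap_mem_drawOn.2 rfl)

theorem drawOn_insert {W : Set V} {u : V} (hex : ∃ a ∈ W, G.Adj u a) :
    E.drawOn (insert u W) =
      E.drawOn W ∪ ⋃ i : {a // a ∈ W ∧ G.Adj u a}, range (E.edgeMap i.2.2) := by
  refine Subset.antisymm (fun z hz => ?_) (union_subset (drawOn_mono (subset_insert _ _))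
    (iUnion_subset fun i => range_edgeMap_subset_draw
      (H := (⊤ : G.Subgraph).induce (insert u W)) ⟨mem_insert _ _, Or.inr i.2.1, i.2.2⟩))
  rcases mem_draw.1 hz with ⟨c, rfl | hc, rfl⟩ | ⟨c, d, ⟨hc, hd, hcd⟩, hz⟩
  · obtain ⟨a, ha, hua⟩ := hex
    exact Or.inr (mem_iUnion.2 ⟨⟨a, ha, hua⟩, 0, E.edge_start hua⟩)
  · exact Or.inl (vertexMap_mem_drawOn.2 hc)
  · have hcd : G.Adj c d := hcd
    rcases hc with rfl | hc
    · rcases hd with rfl | hd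
      · exact absurd rfl hcd.ne
      · exact Or.inr (mem_iUnion.2 ⟨⟨d, hd, hcd⟩, hz⟩)
    · rcases hd with rfl | hd
      · refine Or.inr (mem_iUnion.2 ⟨⟨c, hc, hcd.symm⟩, ?_⟩)
        rwa [← E.edge_symm hcd]
      · exact Or.inl (range_edgeMap_subset_draw
          (H := (⊤ : G.Subgraph).induce W) ⟨hc, hd, hcd⟩ hz)

theorem vertexMap_mem_closure_of_insert [Finite V] {W : Set V} {u : V} (huW : u ∉ W)
    (hex : ∃ a ∈ W, G.Adj u a) {p : ℝ × ℝ} (hp : p ∉ E.drawOn (insert u W))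
    (hu : E.vertexMap u ∈ connectedComponentIn (E.drawOn W)ᶜ p) :
    E.vertexMap u ∈ closure (connectedComponentIn (E.drawOn (insert u W))ᶜ p) := by
  rw [drawOn_insert hex] at hp ⊢
  refine center_mem_closure (isCompact_draw _)
    (fun i : {a // a ∈ W ∧ G.Adj u a} => E.edgeMap i.2.2)
    (fun i => E.edge_inj _) (fun i => E.edge_start _) (fun i => ?_) (fun i t ht h => ?_)
    (fun i j hij z hz => ?_) hp hu
  · rw [E.edge_end]
    exact vertexMap_mem_drawOn.2 i.2.1
  · by_cases h0 : t = 0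
    · rw [h0, E.edge_start] at h
      exact huW (vertexMap_mem_drawOn.1 h)
    · exact huW (adj_of_edgeMap_mem_draw i.2.2 h0 ht h).1
  · have hne : (i : V) ≠ j := fun h => hij (Subtype.ext h)
    obtain ⟨x, ⟨hx, hx'⟩, rfl⟩ := E.edge_int i.2.2 j.2.2 (fun h => by
      rcases Sym2.eq_iff.1 h with ⟨-, h⟩ | ⟨h, h'⟩
      · exact hne h
      · exact j.2.2.ne h) hz
    rcases hx with rfl | rfl
    · rfl
    · rcases hx' with h | h
      · exact absurd h i.2.2.ne'
      · exact absurd h hne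

theorem exists_face_of_adj [Finite V] {u v : V} (h : G.Adj u v) :
    ∃ F, E.IsFace F ∧ E.vertexMap u ∈ closure F ∧ E.vertexMap v ∈ closure F := by
  set H : G.Subgraph := (⊤ : G.Subgraph).deleteEdges {s(u, v)} with hH
  have hun : E.draw H ∪ range (E.edgeMap h) = E.drawing := by
    rw [← draw_subgraphOfAdj, ← draw_sup, ← draw_top]
    congr 1
    ext a b
    · simp [hH]
    · simp only [hH, Subgraph.sup_adj, Subgraph.deleteEdges_adj, Subgraph.top_adj,
        subgraphOfAdj_adj, mem_singleton_iff]
      constructor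
      · rintro (h' | h')
        · exact h'.1
        · rwa [← mem_edgeSet, ← h']
      · intro h'
        by_cases hs : s(a, b) = s(u, v)
        · exact Or.inr hs.symm
        · exact Or.inl ⟨h', hs⟩
  have hint : ∀ t ≠ 0, t ≠ 1 → E.edgeMap h t ∉ E.draw H := fun t h0 h1 ht => by
    have := adj_of_edgeMap_mem_draw h h0 h1 ht
    simp [hH] at this
  have h0 : E.edgeMap h 0 ∈ E.draw H := by
    rw [E.edge_start]; exact vertexMap_mem_draw.2 (mem_univ _)
  have h1 : E.edgeMap h 1 ∈ E.draw H := by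
    rw [E.edge_end]; exact vertexMap_mem_draw.2 (mem_univ _)
  obtain ⟨s, hs0, hs1⟩ := exists_between (zero_lt_one : (0 : unitInterval) < 1)
  obtain ⟨p, hp, hpγ⟩ := exists_notMem_range_of_chord (isCompact_draw H).isClosed (E.edgeMap h)
    h0 h1 hint hs0.ne' hs1.ne
  have hp' : p ∉ E.draw H ∪ range (E.edgeMap h) := fun h' =>
    h'.elim (connectedComponentIn_subset _ _ hp) hpγ
  have := endpoints_mem_closure (isCompact_draw H) (E.edgeMap h) (E.edge_inj h) h0 h1 hint hp'
    hs0.ne' hs1.ne (mem_connectedComponentIn_symm hp)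
  rw [E.edge_start, E.edge_end, hun] at this
  exact ⟨_, ⟨p, hun ▸ hp', rfl⟩, this⟩

theorem exists_face_of_not_separates [Finite V] {u v : V} (hne : u ≠ v) (huv : ¬ G.Adj u v)
    (hconn : (G.induce {u, v}ᶜ).Connected)
    (hu : ∃ a ∈ ({u, v} : Set V)ᶜ, G.Adj u a) (hv : ∃ a ∈ ({u, v} : Set V)ᶜ, G.Adj v a)
    (h : E.vertexMap v ∈ connectedComponentIn (E.drawOn {u, v}ᶜ)ᶜ (E.vertexMap u)) :
    ∃ F, E.IsFace F ∧ E.vertexMap u ∈ closure F ∧ E.vertexMap v ∈ closure F := by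
  have hiu : insert u ({u, v} : Set V)ᶜ = {v}ᶜ := by ext x; by_cases x = u <;> simp_all
  have hiv : insert v ({u, v} : Set V)ᶜ = {u}ᶜ := by
    ext x; by_cases x = v <;> simp_all [hne.symm]
  have hQ := vertexMap_mem_closure_of_insert (by simp) hu
    (p := E.vertexMap v) (by rw [hiu, vertexMap_mem_drawOn]; simp)
    (mem_connectedComponentIn_symm h)
  have hP := vertexMap_mem_closure_of_insert (by simp) hv
    (p := E.vertexMap u) (by rw [hiv, vertexMap_mem_drawOn]; simp) h
  rw [hiu] at hQ
  rw [hiv] at hP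
  set P := connectedComponentIn (E.drawOn {u}ᶜ)ᶜ (E.vertexMap u) with hPdef
  set Q := connectedComponentIn (E.drawOn {v}ᶜ)ᶜ (E.vertexMap v) with hQdef
  have hPo : IsOpen P := (isCompact_draw _).isClosed.isOpen_compl.connectedComponentIn
  have hQo : IsOpen Q := (isCompact_draw _).isClosed.isOpen_compl.connectedComponentIn
  have huP : E.vertexMap u ∈ P := mem_connectedComponentIn (fun h => by
    simpa using vertexMap_mem_drawOn.1 h)
  have hvQ : E.vertexMap v ∈ Q := mem_connectedComponentIn (fun h => by
    simpa using vertexMap_mem_drawOn.1 h)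
  have hu' : E.vertexMap u ∈ closure (P ∩ Q) := hPo.inter_closure ⟨huP, hQ⟩
  have hv' : E.vertexMap v ∈ closure (P ∩ Q) := by
    rw [inter_comm]; exact hQo.inter_closure ⟨hvQ, hP⟩
  obtain ⟨p, hpP, hpQ⟩ := closure_nonempty_iff.1 ⟨_, hu'⟩
  have hun : E.drawOn {u}ᶜ ∪ E.drawOn {v}ᶜ = E.drawing := by
    rw [← drawOn_univ, ← drawOn_union]
    · congr 2
      ext x
      by_cases hx : x = u <;> simp [hx, hne]
    · rintro a ha b hb hab
      by_contra! hcon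
      have h1 : a = v := by simpa using hcon.1
      have h2 : b = u := by simpa using hcon.2
      exact huv (h1 ▸ h2 ▸ hab.symm)
  have hsub : P ∩ Q ⊆ connectedComponentIn E.drawingᶜ p := by
    rintro q ⟨hqP, hqQ⟩
    rw [← hun]
    refine janiszewski (isCompact_draw _) (isCompact_draw _) ?_
      (mem_connectedComponentIn_trans (mem_connectedComponentIn_symm hpP) hqP)
      (mem_connectedComponentIn_trans (mem_connectedComponentIn_symm hpQ) hqQ)
    rw [← drawOn_inter, ← compl_union]
    exact (isPathConnected_drawOn hconn).isConnected.isPreconnected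
  refine ⟨_, ⟨p, ?_, rfl⟩, closure_mono hsub hu', closure_mono hsub hv'⟩
  exact connectedComponentIn_subset _ _ (hsub ⟨hpP, hpQ⟩)

/-- Two vertices of a 3-cut share a face. -/
theorem exists_face_of_components [Finite V] (h3 : IsKConnected 3 G) {u v w : V}
    (huv : u ≠ v) (hvw : v ≠ w) (huw : u ≠ w) {C D : Set V} (hC : IsCompOf G {u, v, w} C)
    (hD : IsCompOf G {u, v, w} D) (hCD : Disjoint C D)
    (hCS : ∀ s ∈ ({u, v, w} : Set V), ∃ c ∈ C, G.Adj s c)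
    (hDS : ∀ s ∈ ({u, v, w} : Set V), ∃ d ∈ D, G.Adj s d) :
    ∃ F, E.IsFace F ∧ E.vertexMap u ∈ closure F ∧ E.vertexMap v ∈ closure F := by
  by_cases hadj : G.Adj u v
  · exact exists_face_of_adj hadj
  have hCout : ∀ a ∈ C, a ≠ u ∧ a ≠ v ∧ a ≠ w := fun a ha => by simpa using hC.2.1 ha
  have hDout : ∀ a ∈ D, a ≠ u ∧ a ≠ v ∧ a ≠ w := fun a ha => by simpa using hD.2.1 ha
  have hnb : ∀ s ∈ ({u, v, w} : Set V), ∃ a ∈ ({u, v} : Set V)ᶜ, G.Adj s a := fun s hs => by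
    obtain ⟨c, hc, hsc⟩ := hCS s hs
    exact ⟨c, by simp [hCout c hc], hsc⟩
  refine exists_face_of_not_separates huv hadj
    (h3.2 _ (toFinite _) (by rw [ncard_pair huv]; norm_num)) (hnb u (by simp)) (hnb v (by simp)) ?_
  have hjoin : ∀ B : Set V, IsCompOf G {u, v, w} B →
      (∀ s ∈ ({u, v, w} : Set V), ∃ c ∈ B, G.Adj s c) →
      JoinedIn (E.drawOn (B ∪ {u, v})) (E.vertexMap u) (E.vertexMap v) := by
    intro B hB hBS
    obtain ⟨c, hc⟩ := hB.1
    exact (joinedIn_drawOn_of_attached hB.2.2.1 subset_union_left (by simp)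
      (hBS u (by simp)) hc).symm.trans
      (joinedIn_drawOn_of_attached hB.2.2.1 subset_union_left (by simp) (hBS v (by simp)) hc)
  have hw : w ∉ C := fun h => (hCout w h).2.2 rfl
  have hunion : ({u, v} : Set V)ᶜ = (C ∪ {w}) ∪ ({u, v} ∪ C)ᶜ := by
    ext x
    by_cases hxC : x ∈ C
    · simp [hxC, hCout x hxC]
    · by_cases hxw : x = w
      · subst hxw; simp [huw.symm, hvw.symm]
      · simp [hxC, hxw]
  have hinter : (C ∪ {w}) ∩ ({u, v} ∪ C)ᶜ = {w} := by
    ext x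
    by_cases hxC : x ∈ C
    · simp [hxC]; rintro rfl; exact hw hxC
    · simp only [union_singleton, mem_inter_iff, mem_insert_iff, hxC, or_false, compl_union,
        mem_compl_iff, mem_singleton_iff, not_false_eq_true, and_true]
      refine ⟨And.left, ?_⟩
      rintro rfl
      simp [huw.symm, hvw.symm]
  rw [hunion, drawOn_union]
  · refine janiszewski (isCompact_draw _) (isCompact_draw _) ?_
      ((hjoin D hD hDS).mem_connectedComponentIn (disjoint_drawOn ?_))
      ((hjoin C hC hCS).mem_connectedComponentIn (disjoint_drawOn ?_))
    · rw [← drawOn_inter, hinter]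
      exact (isPathConnected_drawOn_singleton w).isConnected.isPreconnected
    · rw [Set.disjoint_left]
      rintro x (hx | hx) (hx' | hx')
      · exact Set.disjoint_left.1 hCD hx' hx
      · exact (hDout x hx).2.2 hx'
      · rcases hx with rfl | rfl
        · exact (hCout _ hx').1 rfl
        · exact (hCout _ hx').2.1 rfl
      · rcases hx with rfl | rfl
        · exact huw hx'
        · exact hvw hx'
    · rw [union_comm]
      exact disjoint_compl_right
  · rintro a (ha | rfl) b hb hab
    · right
      by_cases hbw : b = w
      · exact Or.inr hbw
      · refine Or.inl (hC.2.2.2 a ha b ?_ hab)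
        rintro (rfl | rfl | h)
        · exact hb (Or.inl (Or.inl rfl))
        · exact hb (Or.inl (Or.inr rfl))
        · exact hbw h
    · left
      simp [huw.symm, hvw.symm, hw]

theorem draw_subset_drawing (H : G.Subgraph) : E.draw H ⊆ E.drawing :=
  draw_top (E := E) ▸ draw_mono le_top

theorem joinedIn_compl_drawOn_of_mem_closure [Finite V] {p : ℝ × ℝ} (hp : p ∉ E.drawing) {u : V}
    (hu : E.vertexMap u ∈ closure (connectedComponentIn E.drawingᶜ p)) :
    JoinedIn (E.drawOn {u}ᶜ)ᶜ p (E.vertexMap u) := by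
  have hmem := mem_connectedComponentIn_of_mem_closure (draw_subset_drawing _) hp
    (fun h => by simpa using vertexMap_mem_drawOn.1 h : E.vertexMap u ∉ E.drawOn {u}ᶜ) hu
  have hp' : p ∈ (E.drawOn {u}ᶜ)ᶜ := fun h => hp (draw_subset_drawing _ h)
  have hconn := ((isCompact_draw ((⊤ : G.Subgraph).induce {u}ᶜ)
    (E := E)).isClosed.isOpen_compl.connectedComponentIn (x := p)).isConnected_iff_isPathConnected.1
      (isConnected_connectedComponentIn_iff.2 hp')
  exact (hconn.joinedIn _ (mem_connectedComponentIn hp') _ hmem).mono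
    (connectedComponentIn_subset _ _)

/-- No face contains all three vertices of a 3-cut. -/
theorem not_exists_face_of_components [Finite V] {u v w : V}
    (huv : u ≠ v) (hvw : v ≠ w) (huw : u ≠ w) {C D : Set V} (hC : IsCompOf G {u, v, w} C)
    (hD : IsCompOf G {u, v, w} D) (hCD : Disjoint C D)
    (hCS : ∀ s ∈ ({u, v, w} : Set V), ∃ c ∈ C, G.Adj s c)
    (hDS : ∀ s ∈ ({u, v, w} : Set V), ∃ d ∈ D, G.Adj s d)
    {F : Set (ℝ × ℝ)} (hF : E.IsFace F) (hu : E.vertexMap u ∈ closure F)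
    (hv : E.vertexMap v ∈ closure F) (hw : E.vertexMap w ∈ closure F) : False := by
  obtain ⟨p, hp, rfl⟩ := hF
  obtain ⟨x, hx⟩ := hC.1
  obtain ⟨y, hy⟩ := hD.1
  let b : Fin 3 → V := ![u, v, w]
  have hb : Function.Injective b := by
    intro i j h
    fin_cases i <;> fin_cases j <;> simp_all [b]
  have hbS : ∀ j, b j ∈ ({u, v, w} : Set V) := by
    intro j
    fin_cases j <;> simp [b]
  have hbF : ∀ j, E.vertexMap (b j) ∈ closure (connectedComponentIn E.drawingᶜ p) := by
    intro j
    fin_cases j <;> assumption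
  have hbC : ∀ j, b j ∉ C := fun j h => hC.2.1 h (hbS j)
  have hbD : ∀ j, b j ∉ D := fun j h => hD.2.1 h (hbS j)
  have hCz : ∀ j j', j ≠ j' → Disjoint (E.drawOn (C ∪ {b j})) (E.drawOn {b j'}ᶜ)ᶜ := by
    intro j j' hj
    refine disjoint_compl_right.mono_left (drawOn_mono ?_)
    rintro a (ha | rfl)
    · exact fun h => hbC j' (mem_singleton_iff.1 h ▸ ha)
    · exact fun h => hj (hb h)
  have hDz : ∀ j j', j ≠ j' → Disjoint (E.drawOn (D ∪ {b j})) (E.drawOn {b j'}ᶜ)ᶜ := by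
    intro j j' hj
    refine disjoint_compl_right.mono_left (drawOn_mono ?_)
    rintro a (ha | rfl)
    · exact fun h => hbD j' (mem_singleton_iff.1 h ▸ ha)
    · exact fun h => hj (hb h)
  have hCDz : ∀ j j', j ≠ j' → Disjoint (E.drawOn (C ∪ {b j})) (E.drawOn (D ∪ {b j'})) := by
    intro j j' hj
    refine disjoint_drawOn (Set.disjoint_left.2 ?_)
    rintro a (ha | rfl) (ha' | ha')
    · exact Set.disjoint_left.1 hCD ha ha'
    · exact hbC j' (mem_singleton_iff.1 ha' ▸ ha)
    · exact hbD j ha'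
    · exact hj (hb ha')
  refine k33_plane ![E.vertexMap x, E.vertexMap y, p] (E.vertexMap ∘ b)
    (fun i j => ![E.drawOn (C ∪ {b j}), E.drawOn (D ∪ {b j}), (E.drawOn {b j}ᶜ)ᶜ] i)
    (fun i j => ?_) (fun i i' j j' hi hj => ?_)
  · fin_cases i
    · exact joinedIn_drawOn_of_attached hC.2.2.1 subset_union_left (by simp) (hCS _ (hbS j)) hx
    · exact joinedIn_drawOn_of_attached hD.2.2.1 subset_union_left (by simp) (hDS _ (hbS j)) hy
    · exact joinedIn_compl_drawOn_of_mem_closure hp (hbF j)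
  · fin_cases i <;> fin_cases i'
    · exact absurd rfl hi
    · exact hCDz j j' hj
    · exact hCz j j' hj
    · exact (hCDz j' j hj.symm).symm
    · exact absurd rfl hi
    · exact hDz j j' hj
    · exact (hCz j' j hj.symm).symm
    · exact (hDz j' j hj.symm).symm
    · exact absurd rfl hi

end PlaneEmbedding

theorem IsKConnected.exists_adj_notMem [Finite V] {G : SimpleGraph V} {k : ℕ}
    (hG : IsKConnected k G) {S : Set V} (hS : S.ncard = k) {s : V} (hs : s ∈ S) {y : V}
    (hy : y ∉ S) : ∃ a ∉ S, G.Adj s a := by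
  by_contra! hcon
  have hconn := hG.2 (S \ {s}) (toFinite _) (by
    rw [ncard_sdiff_singleton_of_mem hs, hS]
    have := (ncard_pos (toFinite S)).2 ⟨s, hs⟩
    omega)
  have hr := hconn.preconnected ⟨s, fun h => h.2 rfl⟩ ⟨y, fun h => hy h.1⟩
  have := hr.mem_of_forall_adj (C := Subtype.val ⁻¹' {s}) (fun a ha b hab => ?_) rfl
  · have hys : y = s := this
    exact hy (hys ▸ hs)
  · have hab := induce_adj.1 hab
    by_contra hbs
    rw [mem_singleton_iff.1 ha] at hab
    exact hcon b (fun h => b.2 ⟨h, hbs⟩) hab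

namespace PlaneEmbedding

variable {G : SimpleGraph V} {E : PlaneEmbedding G}

/-- Some face of the drawing of `H` has all vertices of `S` on its boundary. -/
def HasFaceTouching (E : PlaneEmbedding G) (H : G.Subgraph) (S : Set V) : Prop :=
  ∃ p ∉ E.draw H, ∀ s ∈ S, E.vertexMap s ∈ closure (connectedComponentIn (E.draw H)ᶜ p)

theorem isPreconnected_draw_deleteVerts {S : Set V} (hconn : (G.induce Sᶜ).Connected)
    (hnb : ∀ s ∈ S, ∃ a ∉ S, G.Adj s a) {H : G.Subgraph} (hverts : H.verts = univ)
    (hadj : ∀ a ∉ S, ∀ b, G.Adj a b → H.Adj a b) {T : Set V} (hT : T ⊆ S) :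
    IsPreconnected (E.draw (H.deleteVerts T)) := by
  have hle : (⊤ : G.Subgraph).induce Sᶜ ≤ H.deleteVerts T := by
    refine ⟨fun a ha => ⟨hverts ▸ mem_univ a, fun h => ha (hT h)⟩, fun a b hab => ?_⟩
    rw [Subgraph.deleteVerts_adj, hverts]
    exact ⟨mem_univ _, fun h => hab.1 (hT h), mem_univ _, fun h => hab.2.1 (hT h),
      hadj a hab.1 b hab.2.2⟩
  obtain ⟨a⟩ := hconn.nonempty
  have hjoin : ∀ b ∉ S, JoinedIn (E.draw (H.deleteVerts T)) (E.vertexMap a) (E.vertexMap b) :=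
    fun b hb => (joinedIn_drawOn_of_reachable (hconn.preconnected a ⟨b, hb⟩)).mono (draw_mono hle)
  refine (isPathConnected_draw (a := (a : V)) (hle.1 a.2) fun b hb => ?_).isConnected.isPreconnected
  by_cases hbS : b ∈ S
  · obtain ⟨c, hc, hbc⟩ := hnb b hbS
    refine (hjoin c hc).trans (joinedIn_draw_of_adj ?_)
    rw [Subgraph.deleteVerts_adj, hverts]
    exact ⟨mem_univ _, fun h => hc (hT h), mem_univ _, hb.2, hadj c hc b hbc.symm⟩
  · exact hjoin b hbS

theorem HasFaceTouching.sup_subgraphOfAdj [Finite V] {S : Set V} {u v w : V} (hS : S = {u, v, w})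
    (hvw : v ≠ w) (huw : u ≠ w) (hconn : (G.induce Sᶜ).Connected)
    (hnb : ∀ s ∈ S, ∃ a ∉ S, G.Adj s a) {H : G.Subgraph} (hverts : H.verts = univ)
    (hadj : ∀ a ∉ S, ∀ b, G.Adj a b → H.Adj a b) (h : E.HasFaceTouching H S)
    (huv : G.Adj u v) (hH : ¬ H.Adj u v) :
    E.HasFaceTouching (H ⊔ G.subgraphOfAdj huv) S := by
  obtain ⟨p, hp, hpS⟩ := h
  set γ := E.edgeMap huv with hγ
  have h0 : γ 0 ∈ E.draw H := by
    rw [hγ, E.edge_start, vertexMap_mem_draw, hverts]; exact mem_univ _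
  have h1 : γ 1 ∈ E.draw H := by
    rw [hγ, E.edge_end, vertexMap_mem_draw, hverts]; exact mem_univ _
  have hint : ∀ t ≠ 0, t ≠ 1 → γ t ∉ E.draw H := fun t ht0 ht1 ht =>
    hH (adj_of_edgeMap_mem_draw huv ht0 ht1 ht)
  have hdraw : E.draw (H ⊔ G.subgraphOfAdj huv) = E.draw H ∪ range γ := by
    rw [draw_sup, draw_subgraphOfAdj]
  set Ω := connectedComponentIn (E.draw H)ᶜ p with hΩ
  by_cases hs : ∃ s, γ s ∈ Ω
  · obtain ⟨s, hs⟩ := hs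
    have hs0 : s ≠ 0 := fun h => connectedComponentIn_subset _ _ hs (h ▸ h0)
    have hs1 : s ≠ 1 := fun h => connectedComponentIn_subset _ _ hs (h ▸ h1)
    set H₁ := H.deleteVerts {w} ⊔ G.subgraphOfAdj huv with hH₁
    have hinf : H₁ ⊓ H = H.deleteVerts {w} := by
      refine le_antisymm ?_ (le_inf le_sup_left Subgraph.deleteVerts_le)
      constructor
      · rintro x ⟨hx | hx, hx'⟩
        · exact hx
        · refine ⟨hx', fun hxw => ?_⟩
          rcases hx with rfl | rfl
          · exact huw hxw
          · exact hvw hxw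
      · rintro x y ⟨hxy | hxy, hxy'⟩
        · exact hxy
        · rw [subgraphOfAdj_adj] at hxy
          rw [← Subgraph.mem_edgeSet, ← hxy, Subgraph.mem_edgeSet] at hxy'
          exact absurd hxy' hH
    have hsup : H₁ ⊔ H = H ⊔ G.subgraphOfAdj huv := by
      refine le_antisymm (sup_le (sup_le_sup_right Subgraph.deleteVerts_le _) le_sup_left)
        (sup_le le_sup_right (le_sup_right.trans le_sup_left))
    have hw : E.vertexMap w ∉ E.draw H₁ := by
      rw [vertexMap_mem_draw]
      rintro (hx | rfl | hx)
      · exact hx.2 rfl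
      · exact huw rfl
      · exact hvw (mem_singleton_iff.1 hx).symm
    set R := connectedComponentIn (E.draw H₁)ᶜ (E.vertexMap w) with hR
    have hRo : IsOpen R := (isCompact_draw H₁).isClosed.isOpen_compl.connectedComponentIn
    have hwR : E.vertexMap w ∈ closure (R ∩ Ω) :=
      hRo.inter_closure ⟨mem_connectedComponentIn hw, hpS w (by simp [hS])⟩
    obtain ⟨q, hqR, hqΩ⟩ := closure_nonempty_iff.1 ⟨_, hwR⟩
    have hsub : R ∩ Ω ⊆ connectedComponentIn (E.draw (H ⊔ G.subgraphOfAdj huv))ᶜ q := by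
      rintro x ⟨hxR, hxΩ⟩
      rw [← hsup, draw_sup]
      refine janiszewski (isCompact_draw _) (isCompact_draw _) ?_
        (mem_connectedComponentIn_trans (mem_connectedComponentIn_symm hqR) hxR)
        (mem_connectedComponentIn_trans (mem_connectedComponentIn_symm hqΩ) hxΩ)
      rw [← draw_inf, hinf]
      exact isPreconnected_draw_deleteVerts hconn hnb hverts hadj (by simp [hS])
    have hq : q ∉ E.draw (H ⊔ G.subgraphOfAdj huv) :=
      connectedComponentIn_subset _ _ (hsub ⟨hqR, hqΩ⟩)
    have hend := endpoints_mem_closure (isCompact_draw H) γ (E.edge_inj huv) h0 h1 hint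
      (hdraw ▸ hq) hs0 hs1 (mem_connectedComponentIn_trans (mem_connectedComponentIn_symm hqΩ) hs)
    rw [← hdraw, hγ, E.edge_start, E.edge_end] at hend
    refine ⟨q, hq, ?_⟩
    rw [hS]
    rintro x (rfl | rfl | rfl)
    · exact hend.1
    · exact hend.2
    · exact closure_mono hsub hwR
  · push Not at hs
    have hΩ' : ∀ x ∈ Ω, x ∉ E.draw (H ⊔ G.subgraphOfAdj huv) := by
      rw [hdraw]
      rintro x hx (h' | ⟨t, rfl⟩)
      · exact connectedComponentIn_subset _ _ hx h'
      · exact hs t hx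
    have hpΩ : p ∈ Ω := mem_connectedComponentIn hp
    exact ⟨p, hΩ' p hpΩ, fun s hs => closure_mono
      (isPreconnected_connectedComponentIn.subset_connectedComponentIn hpΩ hΩ') (hpS s hs)⟩

theorem HasFaceTouching.exists_adj_of_adj [Finite V] {S : Set V} {u v w : V} (hS : S = {u, v, w})
    (hvw : v ≠ w) (huw : u ≠ w) (hconn : (G.induce Sᶜ).Connected)
    (hnb : ∀ s ∈ S, ∃ a ∉ S, G.Adj s a) {H : G.Subgraph} (hverts : H.verts = univ)
    (hadj : ∀ a ∉ S, ∀ b, G.Adj a b → H.Adj a b) (h : E.HasFaceTouching H S) :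
    ∃ H' : G.Subgraph, H ≤ H' ∧ (G.Adj u v → H'.Adj u v) ∧ E.HasFaceTouching H' S := by
  by_cases huv : G.Adj u v ∧ ¬ H.Adj u v
  · exact ⟨H ⊔ G.subgraphOfAdj huv.1, le_sup_left, fun _ => Or.inr (by simp),
      h.sup_subgraphOfAdj hS hvw huw hconn hnb hverts hadj huv.1 huv.2⟩
  · exact ⟨H, le_rfl, fun h' => by_contra fun h'' => huv ⟨h', h''⟩, h⟩

theorem HasFaceTouching.top_of_forall_adj [Finite V] {S : Set V} {u v w : V} (hS : S = {u, v, w})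
    (huv : u ≠ v) (hvw : v ≠ w) (huw : u ≠ w) (hconn : (G.induce Sᶜ).Connected)
    (hnb : ∀ s ∈ S, ∃ a ∉ S, G.Adj s a) {H : G.Subgraph} (hverts : H.verts = univ)
    (hadj : ∀ a ∉ S, ∀ b, G.Adj a b → H.Adj a b) (h : E.HasFaceTouching H S) :
    E.HasFaceTouching ⊤ S := by
  have hv : ∀ {H₁ : G.Subgraph}, H ≤ H₁ → H₁.verts = univ := fun hle =>
    univ_subset_iff.1 (hverts ▸ hle.1)
  have ha : ∀ {H₁ : G.Subgraph}, H ≤ H₁ → ∀ a ∉ S, ∀ b, G.Adj a b → H₁.Adj a b :=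
    fun hle a ha b hab => hle.2 (hadj a ha b hab)
  obtain ⟨H₁, h₁, huv₁, ht₁⟩ := h.exists_adj_of_adj hS hvw huw hconn hnb hverts hadj
  obtain ⟨H₂, h₂, hvw₂, ht₂⟩ := ht₁.exists_adj_of_adj (u := v) (v := w) (w := u)
    (by rw [hS]; ext; simp; tauto) huw.symm huv.symm hconn hnb (hv h₁) (ha h₁)
  obtain ⟨H₃, h₃, huw₃, ht₃⟩ := ht₂.exists_adj_of_adj (u := u) (v := w) (w := v)
    (by rw [hS]; ext; simp; tauto) hvw.symm huv hconn hnb (hv (h₁.trans h₂)) (ha (h₁.trans h₂))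
  have huv₃ : G.Adj u v → H₃.Adj u v := fun h => h₃.2 (h₂.2 (huv₁ h))
  have hvw₃ : G.Adj v w → H₃.Adj v w := fun h => h₃.2 (hvw₂ h)
  have hle := (h₁.trans h₂).trans h₃
  suffices H₃ = ⊤ from this ▸ ht₃
  refine top_le_iff.1 ⟨(hv hle).ge, fun a b hab => ?_⟩
  have hab : G.Adj a b := hab
  by_cases haS : a ∈ S
  · by_cases hbS : b ∈ S
    · rw [hS] at haS hbS
      rcases haS with rfl | rfl | rfl <;> rcases hbS with rfl | rfl | rfl
      · exact absurd rfl hab.ne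
      · exact huv₃ hab
      · exact huw₃ hab
      · exact (huv₃ hab.symm).symm
      · exact absurd rfl hab.ne
      · exact hvw₃ hab
      · exact (huw₃ hab.symm).symm
      · exact (hvw₃ hab.symm).symm
      · exact absurd rfl hab.ne
    · exact (ha hle b hbS a hab.symm).symm
  · exact ha hle a haS b hab

/-- If pairs of `u`, `v`, `w` share faces and `G - {u, v, w}` is connected, then some face of the
graph without the edges among `u`, `v`, `w` touches all three. -/
theorem hasFaceTouching_of_pairs [Finite V] {S : Set V} {u v w : V} (hS : S = {u, v, w})
    (huv : u ≠ v) (hvw : v ≠ w) (huw : u ≠ w) (hconn : (G.induce Sᶜ).Connected)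
    {p q r : ℝ × ℝ} (hp : p ∉ E.drawing) (hq : q ∉ E.drawing) (hr : r ∉ E.drawing)
    (hup : E.vertexMap u ∈ closure (connectedComponentIn E.drawingᶜ p))
    (hvp : E.vertexMap v ∈ closure (connectedComponentIn E.drawingᶜ p))
    (hvq : E.vertexMap v ∈ closure (connectedComponentIn E.drawingᶜ q))
    (hwq : E.vertexMap w ∈ closure (connectedComponentIn E.drawingᶜ q))
    (hur : E.vertexMap u ∈ closure (connectedComponentIn E.drawingᶜ r))
    (hwr : E.vertexMap w ∈ closure (connectedComponentIn E.drawingᶜ r)) :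
    E.HasFaceTouching ((⊤ : G.Subgraph).induce (insert u Sᶜ) ⊔
      ((⊤ : G.Subgraph).induce (insert v Sᶜ) ⊔ (⊤ : G.Subgraph).induce (insert w Sᶜ))) S := by
  set A := (⊤ : G.Subgraph).induce (insert u Sᶜ) with hA
  set B := (⊤ : G.Subgraph).induce (insert v Sᶜ) ⊔ (⊤ : G.Subgraph).induce (insert w Sᶜ) with hB
  have huS : u ∈ S := by simp [hS]
  have hvS : v ∈ S := by simp [hS]
  have hwS : w ∈ S := by simp [hS]
  have huB : E.vertexMap u ∉ E.draw B := by
    simp [vertexMap_mem_draw, hB, huv, huw, huS]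
  have hvA : E.vertexMap v ∉ E.draw A := by
    simp [vertexMap_mem_draw, hA, huv.symm, hvS]
  have hwA : E.vertexMap w ∉ E.draw A := by
    simp [vertexMap_mem_draw, hA, huw.symm, hwS]
  have hinf : E.draw A ∩ E.draw B = E.drawOn Sᶜ := by
    rw [hB, draw_sup, inter_union_distrib_left, hA, ← drawOn_inter, ← drawOn_inter]
    have h1 : insert u Sᶜ ∩ insert v Sᶜ = Sᶜ := by
      ext x; by_cases x ∈ S <;> simp_all
    have h2 : insert u Sᶜ ∩ insert w Sᶜ = Sᶜ := by
      ext x; by_cases x ∈ S <;> simp_all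
    rw [h1, h2, union_self]
  have hB' : r ∈ connectedComponentIn (E.draw B)ᶜ p :=
    mem_connectedComponentIn_trans
      (mem_connectedComponentIn_of_mem_closure (draw_subset_drawing _) hp huB hup)
      (mem_connectedComponentIn_symm
        (mem_connectedComponentIn_of_mem_closure (draw_subset_drawing _) hr huB hur))
  have hA' : r ∈ connectedComponentIn (E.draw A)ᶜ p := by
    have hpq : q ∈ connectedComponentIn (E.draw A)ᶜ p := mem_connectedComponentIn_trans
      (mem_connectedComponentIn_of_mem_closure (draw_subset_drawing _) hp hvA hvp)
      (mem_connectedComponentIn_symm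
        (mem_connectedComponentIn_of_mem_closure (draw_subset_drawing _) hq hvA hvq))
    exact mem_connectedComponentIn_trans hpq (mem_connectedComponentIn_trans
      (mem_connectedComponentIn_of_mem_closure (draw_subset_drawing _) hq hwA hwq)
      (mem_connectedComponentIn_symm
        (mem_connectedComponentIn_of_mem_closure (draw_subset_drawing _) hr hwA hwr)))
  have hpr : r ∈ connectedComponentIn (E.draw (A ⊔ B))ᶜ p := by
    rw [draw_sup]
    refine janiszewski (isCompact_draw _) (isCompact_draw _) ?_ hA' hB'
    rw [hinf]
    exact (isPathConnected_drawOn hconn).isConnected.isPreconnected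
  have hmono : ∀ x, closure (connectedComponentIn E.drawingᶜ x) ⊆
      closure (connectedComponentIn (E.draw (A ⊔ B))ᶜ x) := fun x =>
    closure_mono (connectedComponentIn_mono x (compl_subset_compl.2 (draw_subset_drawing _)))
  refine ⟨p, fun h => hp (draw_subset_drawing _ h), ?_⟩
  rw [hS]
  rintro x (rfl | rfl | rfl)
  · exact hmono p hup
  · exact hmono p hvp
  · rw [connectedComponentIn_eq hpr]
    exact hmono r hwr

end PlaneEmbedding

theorem exists_face_of_pairs [Fintype V] (G : SimpleGraph V) (h3 : IsKConnected 3 G)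
    (E : PlaneEmbedding G) {u v w : V} (huv : u ≠ v) (hvw : v ≠ w) (huw : u ≠ w)
    (hpre : (G.induce ({u, v, w} : Set V)ᶜ).Preconnected) {F₁ F₂ F₃ : Set (ℝ × ℝ)}
    (hF₁ : E.IsFace F₁) (hF₂ : E.IsFace F₂) (hF₃ : E.IsFace F₃)
    (hu₁ : E.vertexMap u ∈ closure F₁) (hv₁ : E.vertexMap v ∈ closure F₁)
    (hv₂ : E.vertexMap v ∈ closure F₂) (hw₂ : E.vertexMap w ∈ closure F₂)
    (hu₃ : E.vertexMap u ∈ closure F₃) (hw₃ : E.vertexMap w ∈ closure F₃) :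
    ∃ F, E.IsFace F ∧ ∀ s ∈ ({u, v, w} : Set V), E.vertexMap s ∈ closure F := by
  obtain ⟨p, hp, rfl⟩ := hF₁
  obtain ⟨q, hq, rfl⟩ := hF₂
  obtain ⟨r, hr, rfl⟩ := hF₃
  have hcard : ({u, v, w} : Set V).ncard = 3 := ncard_eq_three.2 ⟨u, v, w, huv, huw, hvw, rfl⟩
  obtain ⟨y, hy⟩ : ∃ y, y ∉ ({u, v, w} : Set V) := by
    by_contra! h
    have := h3.1
    rw [← ncard_univ, ← eq_univ_of_forall h, hcard] at this
    exact lt_irrefl _ this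
  have hconn : (G.induce ({u, v, w} : Set V)ᶜ).Connected :=
    { preconnected := hpre, nonempty := ⟨⟨y, hy⟩⟩ }
  have hnb : ∀ s ∈ ({u, v, w} : Set V), ∃ a ∉ ({u, v, w} : Set V), G.Adj s a :=
    fun s hs => h3.exists_adj_notMem hcard hs hy
  obtain ⟨z, hz, hzS⟩ := (PlaneEmbedding.hasFaceTouching_of_pairs rfl huv hvw huw hconn hp hq hr
    hu₁ hv₁ hv₂ hw₂ hu₃ hw₃).top_of_forall_adj rfl huv hvw huw hconn hnb
      (by ext x; by_cases x = u <;> by_cases x = v <;> by_cases x = w <;> simp_all) (by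
        intro a ha b hab
        by_cases hb : b ∈ ({u, v, w} : Set V)
        · rcases hb with rfl | rfl | rfl
          · exact Or.inl ⟨Or.inr ha, Or.inl rfl, hab⟩
          · exact Or.inr (Or.inl ⟨Or.inr ha, Or.inl rfl, hab⟩)
          · exact Or.inr (Or.inr ⟨Or.inr ha, Or.inl rfl, hab⟩)
        · exact Or.inl ⟨Or.inr ha, Or.inr hb, hab⟩)
  rw [PlaneEmbedding.draw_top] at hz hzS
  exact ⟨_, ⟨z, hz, rfl⟩, hzS⟩

/-- Three distinct vertices form a 3-cut in a 3-connected planar graph iff each pair of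
them shares a face, but no face contains all three. -/
theorem stmt19 [Fintype V] (G : SimpleGraph V) (h3 : IsKConnected 3 G)
    (E : PlaneEmbedding G) (u v w : V)
    (huv : u ≠ v) (hvw : v ≠ w) (huw : u ≠ w) :
    IsThreeCut G {u, v, w} ↔
      ((∃ F, E.IsFace F ∧ E.vertexMap u ∈ frontier F ∧ E.vertexMap v ∈ frontier F) ∧
       (∃ F, E.IsFace F ∧ E.vertexMap v ∈ frontier F ∧ E.vertexMap w ∈ frontier F) ∧
       (∃ F, E.IsFace F ∧ E.vertexMap u ∈ frontier F ∧ E.vertexMap w ∈ frontier F) ∧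
       ¬ ∃ F, E.IsFace F ∧ E.vertexMap u ∈ frontier F ∧ E.vertexMap v ∈ frontier F ∧
         E.vertexMap w ∈ frontier F) := by
  have hfr : ∀ {F}, E.IsFace F → ∀ a, E.vertexMap a ∈ frontier F ↔ E.vertexMap a ∈ closure F :=
    fun hF a => PlaneEmbedding.mem_frontier_iff_of_isFace hF a
  constructor
  · intro hcut
    obtain ⟨C, D, hC, hD, hCD, hCS, hDS⟩ := hcut.exists_components h3
    have h1 : ({u, v, w} : Set V) = {v, w, u} := by ext; simp; tauto
    have h2 : ({u, v, w} : Set V) = {u, w, v} := by ext; simp; tauto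
    refine ⟨?_, ?_, ?_, ?_⟩
    · obtain ⟨F, hF, hFu, hFv⟩ := PlaneEmbedding.exists_face_of_components (E := E) h3 huv hvw huw
        hC hD hCD hCS hDS
      exact ⟨F, hF, (hfr hF u).2 hFu, (hfr hF v).2 hFv⟩
    · obtain ⟨F, hF, hFv, hFw⟩ := PlaneEmbedding.exists_face_of_components (E := E) h3 hvw huw.symm
        huv.symm (h1 ▸ hC) (h1 ▸ hD) hCD (h1 ▸ hCS) (h1 ▸ hDS)
      exact ⟨F, hF, (hfr hF v).2 hFv, (hfr hF w).2 hFw⟩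
    · obtain ⟨F, hF, hFu, hFw⟩ := PlaneEmbedding.exists_face_of_components (E := E) h3 huw hvw.symm
        huv (h2 ▸ hC) (h2 ▸ hD) hCD (h2 ▸ hCS) (h2 ▸ hDS)
      exact ⟨F, hF, (hfr hF u).2 hFu, (hfr hF w).2 hFw⟩
    · rintro ⟨F, hF, hFu, hFv, hFw⟩
      rw [hfr hF] at hFu hFv hFw
      exact PlaneEmbedding.not_exists_face_of_components huv hvw huw hC hD hCD hCS hDS hF
        hFu hFv hFw
  · rintro ⟨⟨F₁, hF₁, hu₁, hv₁⟩, ⟨F₂, hF₂, hv₂, hw₂⟩, ⟨F₃, hF₃, hu₃, hw₃⟩, hno⟩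
    refine ⟨ncard_eq_three.2 ⟨u, v, w, huv, huw, hvw, rfl⟩, fun hpre => hno ?_⟩
    rw [hfr hF₁] at hu₁ hv₁
    rw [hfr hF₂] at hv₂ hw₂
    rw [hfr hF₃] at hu₃ hw₃
    obtain ⟨F, hF, hFS⟩ := exists_face_of_pairs G h3 E huv hvw huw hpre hF₁ hF₂ hF₃
      hu₁ hv₁ hv₂ hw₂ hu₃ hw₃
    exact ⟨F, hF, (hfr hF u).2 (hFS u (by simp)), (hfr hF v).2 (hFS v (by simp)),
      (hfr hF w).2 (hFS w (by simp))⟩
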